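/- arXiv:2204.13472 — 13 statements merged into one kernel-verified Lean document; each statement's English description precedes it below -/
import Mathlib

section
/- Let k be a field of characteristic different from 2 and 3, let a, b ∈ k, let L be a field extension of k, and let n ∈ L be transcendental over k. If x₀, x₁, x₂, x₃ ∈ L satisfy 3x₁² + a·x₀² = 0, 3x₂² + a·x₀² = 0, 3x₃² + a·x₀² = 0, and 2a(x₁+x₂+x₃)x₀ + 3(3b−n)x₀² = 0, then x₀ = x₁ = x₂ = x₃ = 0. -/
/-- If `3 x² + a y² = 0` with `a` in the base field and `y ≠ 0`, then `x / y` is integral. -/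
theorem isIntegral_div_of_three_mul_sq_add_mul_sq {k L : Type*} [Field k] [Field L] [Algebra k L]
    (h3 : (3 : L) ≠ 0) (a : k) {x y : L} (hy : y ≠ 0)
    (h : 3 * x ^ 2 + algebraMap k L a * y ^ 2 = 0) : IsIntegral k (x / y) := by
  have hsq : (x / y) ^ 2 = algebraMap k L (-a / 3) := by
    rw [map_div₀, map_neg, map_ofNat]
    field_simp
    linear_combination h
  exact .of_pow two_pos (hsq ▸ isIntegral_algebraMap)

/-- If `k` has characteristic different from 2 and 3, `a b ∈ k`, `L/k` is a field extension,
and `n ∈ L` is transcendental over `k`, then the only common zero of the four partial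
derivatives of `G = x₁³ + x₂³ + x₃³ + a(x₁+x₂+x₃)x₀² + (3b−n)x₀³` is the trivial one. -/
theorem generic_fibre_smooth {k L : Type*} [Field k] [Field L] [Algebra k L]
    (h2 : (2 : k) ≠ 0) (h3 : (3 : k) ≠ 0)
    (a b : k) (n : L) (hn : Transcendental k n)
    (x₀ x₁ x₂ x₃ : L)
    (e1 : 3 * x₁ ^ 2 + algebraMap k L a * x₀ ^ 2 = 0)
    (e2 : 3 * x₂ ^ 2 + algebraMap k L a * x₀ ^ 2 = 0)
    (e3 : 3 * x₃ ^ 2 + algebraMap k L a * x₀ ^ 2 = 0)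
    (e0 : 2 * algebraMap k L a * (x₁ + x₂ + x₃) * x₀
        + 3 * (3 * algebraMap k L b - n) * x₀ ^ 2 = 0) :
    x₀ = 0 ∧ x₁ = 0 ∧ x₂ = 0 ∧ x₃ = 0 := by
  have h3L : (3 : L) ≠ 0 := by
    simpa only [map_ofNat] using (map_ne_zero (algebraMap k L)).mpr h3
  have hx₀ : x₀ = 0 := by
    by_contra hx₀
    have hint {x : L} (h : 3 * x ^ 2 + algebraMap k L a * x₀ ^ 2 = 0) : IsIntegral k (x / x₀) :=
      isIntegral_div_of_three_mul_sq_add_mul_sq h3L a hx₀ h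
    have hn_eq : n = algebraMap k L (2 * a / 3) * (x₁ / x₀ + x₂ / x₀ + x₃ / x₀)
        + algebraMap k L (3 * b) := by
      simp only [map_div₀, map_mul, map_ofNat]
      field_simp
      apply mul_right_cancel₀ hx₀
      linear_combination -e0
    refine hn (IsIntegral.isAlgebraic ?_)
    rw [hn_eq]
    exact (isIntegral_algebraMap.mul (((hint e1).add (hint e2)).add (hint e3))).add
      isIntegral_algebraMap
  subst hx₀
  simp_all
end

section
/- Let L be a field of characteristic different from 2 and 3, let a, c, r ∈ L with a ≠ 0 and r³ + a·r + c = 0. Set f₂(X) = X³ − 12a·X² + 36a²·X + (27c² + 4a³) ∈ L[X], g₁(Y) = a·Y³ + 3r²·Y² − 3r²·Y + (4a + 3r²) ∈ L[Y], and q(Y) = −(a·Y² + (3r² − a)·Y − (4a + 3r²)) ∈ L[Y]. Then g₁(Y) divides the composite polynomial f₂(q(Y)) in L[Y]; equivalently, the L-algebra homomorphism ξ : L[X] → L[Y] sending X to q(Y) maps the ideal generated by f₂ into the ideal generated by g₁. -/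
open Polynomial

/-- Let `L` have characteristic different from 2 and 3, `a c r ∈ L` with `a ≠ 0` and
`r³ + a r + c = 0`. Then `g₁(Y)` divides `f₂(q(Y))`, i.e. the `L`-algebra homomorphism
`ξ : L[X] → L[Y]`, `X ↦ q(Y)`, maps the ideal `(f₂)` into the ideal `(g₁)`. -/
theorem g1_dvd_f2_comp_q {L : Type*} [Field L]
    (h2 : (2 : L) ≠ 0) (h3 : (3 : L) ≠ 0)
    (a c r : L) (ha : a ≠ 0) (hr : r ^ 3 + a * r + c = 0) :
    (C a * X ^ 3 + C (3 * r ^ 2) * X ^ 2 - C (3 * r ^ 2) * X + C (4 * a + 3 * r ^ 2)) ∣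
      (X ^ 3 - C (12 * a) * X ^ 2 + C (36 * a ^ 2) * X + C (27 * c ^ 2 + 4 * a ^ 3)).comp
        (-(C a * X ^ 2 + C (3 * r ^ 2 - a) * X - C (4 * a + 3 * r ^ 2))) := by
  obtain rfl : c = -(r ^ 3 + a * r) := by linear_combination hr
  refine ⟨-C (a ^ 2) * X ^ 3 + C (3 * a ^ 2 - 6 * a * r ^ 2) * X ^ 2
    + C (-9 * r ^ 4 + 15 * a * r ^ 2 - 3 * a ^ 2) * X
    + C (18 * r ^ 4 - 6 * a * r ^ 2 + 5 * a ^ 2), ?_⟩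
  simp only [add_comp, sub_comp, mul_comp, pow_comp, X_comp, C_comp]
  simp only [map_add, map_sub, map_mul, map_pow, map_neg, map_ofNat]
  ring
end

section
/- Let F = ℚ(a, b, n) be the field of rational functions in three independent variables a, b, n over ℚ, and define f₁ = X³ + a·X + (3b − n) and f₂ = X³ − 12a·X² + 36a²·X + (27(3b−n)² + 4a³) in F[X]. Then the Galois group of the splitting field of the product f₁·f₂ over F is isomorphic to S₃ × S₃ (in particular, this splitting field has degree 36 over F). -/
open Polynomial

/-- The field `ℚ(a, b, n)` of rational functions in three independent variables over `ℚ`. -/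
noncomputable abbrev RatFuncField : Type := FractionRing (MvPolynomial (Fin 3) ℚ)

/-- The variable `a` of `ℚ(a, b, n)`. -/
noncomputable def varA : RatFuncField :=
  algebraMap (MvPolynomial (Fin 3) ℚ) RatFuncField (MvPolynomial.X 0)

/-- The variable `b` of `ℚ(a, b, n)`. -/
noncomputable def varB : RatFuncField :=
  algebraMap (MvPolynomial (Fin 3) ℚ) RatFuncField (MvPolynomial.X 1)

/-- The variable `n` of `ℚ(a, b, n)`. -/
noncomputable def varN : RatFuncField :=
  algebraMap (MvPolynomial (Fin 3) ℚ) RatFuncField (MvPolynomial.X 2)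

/-- `f₁ = X³ + aX + (3b − n)` over `ℚ(a, b, n)`. -/
noncomputable def genF₁ : Polynomial RatFuncField :=
  X ^ 3 + C varA * X + C (3 * varB - varN)

/-- `f₂ = X³ − 12aX² + 36a²X + (27(3b−n)² + 4a³)` over `ℚ(a, b, n)`. -/
noncomputable def genF₂ : Polynomial RatFuncField :=
  X ^ 3 - C (12 * varA) * X ^ 2 + C (36 * varA ^ 2) * X
    + C (27 * (3 * varB - varN) ^ 2 + 4 * varA ^ 3)

open Equiv

section GroupTheory

variable {G : Type*} [Group G]

/-- In `S₃`, two odd permutations fixing `i` and `j` respectively are conjugate under any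
permutation sending `i` to `j`. -/
theorem eq_conj_of_sign_eq_neg_one :
    ∀ (i j : Fin 3) (τ s g : Perm (Fin 3)), Perm.sign τ = -1 → Perm.sign s = -1 → τ i = i →
      s j = j → g i = j → s = g * τ * g⁻¹ := by
  set_option synthInstance.maxHeartbeats 200000 in
  set_option synthInstance.maxSize 1000 in
  decide

theorem exists_fixed_of_sign_eq_neg_one :
    ∀ s : Perm (Fin 3), Perm.sign s = -1 → ∃ i, s i = i := by
  decide

/-- If `φ` has transitive image in `S₃` and `ψ` and the signs allow an element on which `φ` is odd
and `ψ` is even, then `φ` maps the kernel of `ψ` onto `S₃`. -/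
theorem exists_map_eq_of_sign (φ ψ : G →* Perm (Fin 3)) (hφ : ∀ i j, ∃ g, φ g i = j)
    {g₀ : G} (h₁ : Perm.sign (φ g₀) = -1) (h₂ : Perm.sign (ψ g₀) = 1) (s : Perm (Fin 3)) :
    ∃ g, φ g = s ∧ ψ g = 1 := by
  have hτ : Perm.sign (φ (g₀ ^ 3)) = -1 := by simp [h₁, Int.units_pow_eq_pow_mod_two]
  have hker : ψ (g₀ ^ 3) = 1 := by
    have : ∀ t : Perm (Fin 3), Perm.sign t = 1 → t ^ 3 = 1 := by decide
    rw [map_pow, this _ h₂]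
  have hodd : ∀ s : Perm (Fin 3), Perm.sign s = -1 → ∃ g, φ g = s ∧ ψ g = 1 := by
    intro s hs
    obtain ⟨i, hi⟩ := exists_fixed_of_sign_eq_neg_one _ hτ
    obtain ⟨j, hj⟩ := exists_fixed_of_sign_eq_neg_one _ hs
    obtain ⟨g, hg⟩ := hφ i j
    refine ⟨g * g₀ ^ 3 * g⁻¹, ?_, ?_⟩
    · rw [map_mul, map_mul, map_inv]
      exact (eq_conj_of_sign_eq_neg_one i j _ s _ hτ hs hi hj hg).symm
    · rw [map_mul, map_mul, map_inv, hker, mul_one, mul_inv_cancel]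
  rcases Int.units_eq_one_or (Perm.sign s) with hs | hs
  · obtain ⟨g, hg, hg'⟩ := hodd (s * (φ (g₀ ^ 3))⁻¹) (by
      rw [Perm.sign_mul, Perm.sign_inv, hs, hτ, one_mul])
    exact ⟨g * g₀ ^ 3, by rw [map_mul, hg, inv_mul_cancel_right],
      by rw [map_mul, hg', hker, one_mul]⟩
  · exact hodd s hs

/-- Two transitive actions on three letters whose signs are nontrivial and distinct together have
image `S₃ × S₃`. -/
theorem prod_surjective_of_sign (φ ψ : G →* Perm (Fin 3)) (hφ : ∀ i j, ∃ g, φ g i = j)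
    (hψ : ∀ i j, ∃ g, ψ g i = j) (h₁ : ∃ g, Perm.sign (φ g) ≠ 1) (h₂ : ∃ g, Perm.sign (ψ g) ≠ 1)
    (h₁₂ : ∃ g, Perm.sign (φ g) ≠ Perm.sign (ψ g)) : Function.Surjective (φ.prod ψ) := by
  have key : (∃ g, Perm.sign (φ g) = -1 ∧ Perm.sign (ψ g) = 1) ∧
      ∃ g, Perm.sign (ψ g) = -1 ∧ Perm.sign (φ g) = 1 := by
    obtain ⟨a, ha⟩ := h₁
    obtain ⟨b, hb⟩ := h₂
    obtain ⟨c, hc⟩ := h₁₂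
    replace ha := (Int.units_eq_one_or _).resolve_left ha
    replace hb := (Int.units_eq_one_or _).resolve_left hb
    rcases Int.units_eq_one_or (Perm.sign (φ c)) with hc₁ | hc₁ <;>
      rcases Int.units_eq_one_or (Perm.sign (ψ c)) with hc₂ | hc₂
    · exact absurd (hc₁.trans hc₂.symm) hc
    · refine ⟨?_, c, hc₂, hc₁⟩
      rcases Int.units_eq_one_or (Perm.sign (ψ a)) with h | h
      · exact ⟨a, ha, h⟩
      · exact ⟨a * c, by simp [ha, hc₁], by simp [h, hc₂]⟩
    · refine ⟨⟨c, hc₁, hc₂⟩, ?_⟩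
      rcases Int.units_eq_one_or (Perm.sign (φ b)) with h | h
      · exact ⟨b, hb, h⟩
      · exact ⟨b * c, by simp [hb, hc₂], by simp [h, hc₁]⟩
    · exact absurd (hc₁.trans hc₂.symm) hc
  obtain ⟨⟨a, ha₁, ha₂⟩, b, hb₁, hb₂⟩ := key
  rintro ⟨s, t⟩
  obtain ⟨g, hg, hg'⟩ := exists_map_eq_of_sign φ ψ hφ ha₁ ha₂ s
  obtain ⟨h, hh, hh'⟩ := exists_map_eq_of_sign ψ φ hψ hb₁ hb₂ t
  exact ⟨g * h, by simp [hg, hg', hh, hh']⟩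

end GroupTheory

section Cubics

variable {F K : Type*} [Field F] [Field K] [Algebra F K]

/-- Automorphisms that permute the entries of an injective family act through permutations of the
index set. -/
theorem exists_permHom {ι : Type*} [Finite ι] (x : ι → K) (hx : Function.Injective x)
    (h : ∀ (σ : Gal(K/F)) (i : ι), ∃ j, σ (x i) = x j) :
    ∃ φ : Gal(K/F) →* Perm ι, ∀ σ i, σ (x i) = x (φ σ i) := by
  choose f hf using h
  have hinj (σ : Gal(K/F)) : Function.Injective (f σ) := fun i j hij ↦
    hx (σ.injective (by rw [hf, hf, hij]))
  refine ⟨MonoidHom.mk' (fun σ ↦ ofBijective (f σ) (Finite.injective_iff_bijective.mp (hinj σ)))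
    fun σ τ ↦ ?_, fun σ i ↦ hf σ i⟩
  ext i
  apply hx
  change x (f (σ * τ) i) = x (f σ (f τ i))
  rw [← hf, ← hf, ← hf, AlgEquiv.mul_apply]

/-- The Galois action on the three roots of an irreducible cubic that splits: it is transitive, and
the sign of the permutation describes the action on a square root of the discriminant. -/
theorem Cubic.exists_galois_permHom [Normal F K] (P : Cubic F) (ha : P.a ≠ 0)
    (hirr : Irreducible P.toPoly) (hd : P.discr ≠ 0)
    (hs : (P.toPoly.map (algebraMap F K)).Splits) :
    ∃ (x : Fin 3 → K) (δ : K) (φ : Gal(K/F) →* Perm (Fin 3)),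
      (∀ y ∈ P.toPoly.rootSet K, ∃ i, x i = y) ∧ (∀ σ i, σ (x i) = x (φ σ i)) ∧
      (∀ i j, ∃ σ, φ σ i = j) ∧ δ ^ 2 = algebraMap F K P.discr ∧
      ∀ σ, σ δ = ((Perm.sign (φ σ) : ℤ) : K) * δ := by
  obtain ⟨x₀, x₁, x₂, h3⟩ := (Cubic.splits_iff_roots_eq_three ha).mp hs
  obtain ⟨h01, h02, h12⟩ := (Cubic.discr_ne_zero_iff_roots_ne ha h3).mp hd
  have hdisc := Cubic.discr_eq_prod_three_roots ha h3
  set x : Fin 3 → K := ![x₀, x₁, x₂] with hxdef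
  have hroot : ∀ y, aeval y P.toPoly = 0 ↔ ∃ i, x i = y := by
    intro y
    have hne : (Cubic.map (algebraMap F K) P).toPoly ≠ 0 := by
      rw [Cubic.map_toPoly]
      exact Polynomial.map_ne_zero hirr.ne_zero
    have : aeval y P.toPoly = 0 ↔ y ∈ (Cubic.map (algebraMap F K) P).roots := by
      rw [Cubic.roots, mem_roots hne, Cubic.map_toPoly, IsRoot, eval_map_algebraMap]
    rw [this, h3]
    simp [hxdef, Fin.exists_fin_succ, eq_comm]
  have hx : Function.Injective x := by
    intro i j hij
    fin_cases i <;> fin_cases j <;> simp_all [eq_comm]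
  obtain ⟨φ, hφ⟩ := exists_permHom (F := F) x hx fun σ i ↦ by
    obtain ⟨j, hj⟩ := (hroot (σ (x i))).mp (by
      rw [Polynomial.aeval_algHom_apply σ, (hroot (x i)).mpr ⟨i, rfl⟩, map_zero])
    exact ⟨j, hj.symm⟩
  refine ⟨x, algebraMap F K P.a * algebraMap F K P.a * (Matrix.vandermonde x).det, φ, ?_, hφ,
    ?_, ?_, ?_⟩
  · exact fun y hy ↦ (hroot y).mp (aeval_eq_zero_of_mem_rootSet hy)
  · intro i j
    have hi := (hroot (x i)).mpr ⟨i, rfl⟩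
    have hj := (hroot (x j)).mpr ⟨j, rfl⟩
    obtain ⟨σ, hσ⟩ := minpoly.exists_algEquiv_of_root' (K := F) (x := x j) (y := x i)
      ⟨_, hirr.ne_zero, hi⟩ (by
        rw [← minpoly.eq_of_irreducible hirr hi, map_mul, hj, zero_mul])
    exact ⟨σ, hx (by rw [← hφ, hσ])⟩
  · rw [hdisc, Matrix.det_fin_three]
    simp [Matrix.vandermonde_apply, hxdef]
    ring
  · intro σ
    rw [map_mul, map_mul, AlgEquiv.commutes, AlgEquiv.map_det]
    have : (Matrix.vandermonde x).map σ = (Matrix.vandermonde x).submatrix (φ σ) id := by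
      ext i j
      simp [Matrix.vandermonde_apply, hφ]
    change _ * ((Matrix.vandermonde x).map σ).det = _
    rw [this, Matrix.det_permute]
    ring

/-- If an element of a Galois extension squares to a nonsquare of the base field, then some
automorphism moves it. -/
theorem exists_apply_ne_of_sq [IsGalois F K] [FiniteDimensional F K] {d : F} (hd : ¬IsSquare d)
    {δ : K} (hδ : δ ^ 2 = algebraMap F K d) : ∃ σ : Gal(K/F), σ δ ≠ δ := by
  by_contra! h
  obtain ⟨y, rfl⟩ := (IsGalois.mem_range_algebraMap_iff_fixed δ).mpr h
  refine hd ⟨y, (algebraMap F K).injective ?_⟩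
  rw [← hδ, map_mul, pow_two]

/-- The product of two irreducible cubics whose discriminants are independent modulo squares has
Galois group `S₃ × S₃`. -/
theorem Cubic.nonempty_gal_mulEquiv_perm_prod [CharZero F] (P Q : Cubic F) (hPa : P.a ≠ 0)
    (hQa : Q.a ≠ 0) (hP : Irreducible P.toPoly) (hQ : Irreducible Q.toPoly)
    (hPd : ¬IsSquare P.discr) (hQd : ¬IsSquare Q.discr) (hPQ : ¬IsSquare (P.discr * Q.discr)) :
    Nonempty ((P.toPoly * Q.toPoly).Gal ≃* Perm (Fin 3) × Perm (Fin 3)) := by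
  have hne : P.toPoly * Q.toPoly ≠ 0 := mul_ne_zero hP.ne_zero hQ.ne_zero
  let K := (P.toPoly * Q.toPoly).SplittingField
  have : IsGalois F K := { }
  have hspl : ((P.toPoly * Q.toPoly).map (algebraMap F K)).Splits := SplittingField.splits _
  have hPs : (P.toPoly.map (algebraMap F K)).Splits :=
    hspl.of_dvd (Polynomial.map_ne_zero hne) (Polynomial.map_dvd _ (dvd_mul_right _ _))
  have hQs : (Q.toPoly.map (algebraMap F K)).Splits :=
    hspl.of_dvd (Polynomial.map_ne_zero hne) (Polynomial.map_dvd _ (dvd_mul_left _ _))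
  obtain ⟨x, δ, φ, hx, hφx, hφt, hδ, hφs⟩ := P.exists_galois_permHom hPa hP
    (fun h ↦ hPd (h ▸ IsSquare.zero)) hPs
  obtain ⟨y, ε, ψ, hy, hψy, hψt, hε, hψs⟩ := Q.exists_galois_permHom hQa hQ
    (fun h ↦ hQd (h ▸ IsSquare.zero)) hQs
  have hsurj : Function.Surjective (φ.prod ψ) := by
    apply prod_surjective_of_sign φ ψ hφt hψt
    · obtain ⟨σ, hσ⟩ := exists_apply_ne_of_sq hPd hδ
      exact ⟨σ, fun h ↦ hσ (by simp [hφs, h])⟩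
    · obtain ⟨σ, hσ⟩ := exists_apply_ne_of_sq hQd hε
      exact ⟨σ, fun h ↦ hσ (by simp [hψs, h])⟩
    · obtain ⟨σ, hσ⟩ := exists_apply_ne_of_sq (δ := δ * ε) hPQ (by rw [mul_pow, hδ, hε, map_mul])
      refine ⟨σ, fun h ↦ hσ ?_⟩
      rw [map_mul, hφs, hψs, h]
      rcases Int.units_eq_one_or (Perm.sign (ψ σ)) with h | h <;> rw [h] <;> push_cast <;> ring
  have hinj : Function.Injective (φ.prod ψ) := by
    rw [injective_iff_map_eq_one]
    intro σ hσ
    have h₁ : φ σ = 1 := congrArg Prod.fst hσ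
    have h₂ : ψ σ = 1 := congrArg Prod.snd hσ
    refine Gal.ext (p := P.toPoly * Q.toPoly) fun z hz ↦ ?_
    have hz' := aeval_eq_zero_of_mem_rootSet hz
    rw [map_mul, mul_eq_zero] at hz'
    rcases hz' with hz' | hz'
    · obtain ⟨i, rfl⟩ := hx z (mem_rootSet.mpr ⟨hP.ne_zero, hz'⟩)
      exact (hφx σ i).trans (by rw [h₁]; rfl)
    · obtain ⟨i, rfl⟩ := hy z (mem_rootSet.mpr ⟨hQ.ne_zero, hz'⟩)
      exact (hψy σ i).trans (by rw [h₂]; rfl)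
  exact ⟨MulEquiv.ofBijective (φ.prod ψ) ⟨hinj, hsurj⟩⟩

end Cubics

section Specialization

variable {R F S : Type*} [CommRing R] [IsIntegrallyClosed R] [Field F] [Algebra R F]
  [IsFractionRing R F] [CommRing S]

/-- An element of an integrally closed domain that is a square in the fraction field specializes
to squares. -/
theorem IsSquare.map_of_isSquare_algebraMap (f : R →+* S) {r : R}
    (h : IsSquare (algebraMap R F r)) : IsSquare (f r) := by
  obtain ⟨y, hy⟩ := h
  obtain ⟨z, rfl⟩ := IsIntegrallyClosed.exists_algebraMap_eq_of_isIntegral_pow (R := R) (x := y)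
    two_pos (by rw [pow_two, ← hy]; exact isIntegral_algebraMap)
  refine ⟨f z, ?_⟩
  rw [← map_mul]
  exact congrArg f (IsFractionRing.injective R F (by rw [hy, map_mul]))

/-- A monic cubic over an integrally closed domain is irreducible over the fraction field as soon
as some specialization has no root. -/
theorem Polynomial.Monic.irreducible_map_of_specialization (f : R →+* S) {p : R[X]} (hp : p.Monic)
    (hdeg : p.natDegree = 3) (h : ∀ s : S, eval₂ f s p ≠ 0) :
    Irreducible (p.map (algebraMap R F)) := by
  have hdeg' : (p.map (algebraMap R F)).natDegree = 3 := by rw [hp.natDegree_map, hdeg]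
  refine irreducible_of_degree_le_three_of_not_isRoot (by rw [hdeg']; decide) fun x hx ↦ ?_
  rw [IsRoot, eval_map] at hx
  obtain ⟨r, rfl⟩ := IsIntegrallyClosed.isIntegral_iff.mp (⟨p, hp, hx⟩ : IsIntegral R x)
  rw [eval₂_at_apply] at hx
  have hr : p.eval r = 0 := IsFractionRing.injective R F (by rw [hx, map_zero])
  exact h (f r) (by rw [eval₂_at_apply, hr, map_zero])

end Specialization

/-- An integer that is not a cube modulo `7` is not a cube in `ℚ`. -/
theorem Rat.pow_three_ne_intCast {m : ℤ} (hm : ∀ y : ZMod 7, y ^ 3 ≠ m) (x : ℚ) :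
    x ^ 3 ≠ m := by
  intro hx
  obtain ⟨y, rfl⟩ := IsIntegrallyClosed.exists_algebraMap_eq_of_isIntegral_pow (R := ℤ) (x := x)
    three_pos (by rw [hx]; exact isIntegral_algebraMap (R := ℤ) (x := m))
  have : y ^ 3 = m := by
    rw [eq_intCast] at hx
    exact_mod_cast hx
  exact hm y (by rw [← this]; push_cast; rfl)

section Generic

open MvPolynomial (X)

/-- `f₁` with coefficients in `ℚ[a, b, n]`. -/
noncomputable def cubic₁ : Cubic (MvPolynomial (Fin 3) ℚ) :=
  ⟨1, 0, X 0, 3 * X 1 - X 2⟩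

/-- `f₂` with coefficients in `ℚ[a, b, n]`. -/
noncomputable def cubic₂ : Cubic (MvPolynomial (Fin 3) ℚ) :=
  ⟨1, -(12 * X 0), 36 * X 0 ^ 2, 27 * (3 * X 1 - X 2) ^ 2 + 4 * X 0 ^ 3⟩

theorem toPoly_map_cubic₁ :
    (cubic₁.map (algebraMap (MvPolynomial (Fin 3) ℚ) RatFuncField)).toPoly = genF₁ := by
  simp [cubic₁, Cubic.map, Cubic.toPoly, genF₁, varA, varB, varN,
    map_ofNat (algebraMap _ RatFuncField)]

theorem toPoly_map_cubic₂ :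
    (cubic₂.map (algebraMap (MvPolynomial (Fin 3) ℚ) RatFuncField)).toPoly = genF₂ := by
  simp [cubic₂, Cubic.map, Cubic.toPoly, genF₂, varA, varB, varN,
    map_ofNat (algebraMap _ RatFuncField)]
  ring

theorem Cubic.map_discr {R S : Type*} [CommRing R] [CommRing S] (f : R →+* S) (P : Cubic R) :
    (P.map f).discr = f P.discr := by
  simp [Cubic.discr, Cubic.map, map_ofNat]

theorem irreducible_genF₁ : Irreducible genF₁ := by
  rw [← toPoly_map_cubic₁, Cubic.map_toPoly]
  refine Monic.irreducible_map_of_specialization (MvPolynomial.eval ![0, 0, -2])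
    (Cubic.monic_of_a_eq_one rfl) (Cubic.natDegree_of_a_ne_zero one_ne_zero) fun s hs ↦ ?_
  simp [cubic₁, Cubic.toPoly] at hs
  exact Rat.pow_three_ne_intCast (m := -2) (by decide) s (by push_cast; linarith)

theorem irreducible_genF₂ : Irreducible genF₂ := by
  rw [← toPoly_map_cubic₂, Cubic.map_toPoly]
  refine Monic.irreducible_map_of_specialization (MvPolynomial.eval ![0, 0, -2])
    (Cubic.monic_of_a_eq_one rfl) (Cubic.natDegree_of_a_ne_zero one_ne_zero) fun s hs ↦ ?_
  simp [cubic₂, Cubic.toPoly, eval₂_pow] at hs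
  exact Rat.pow_three_ne_intCast (m := -108) (by decide) s (by push_cast; linarith)

/-- A polynomial taking a negative value is not a square in the field of rational functions. -/
theorem not_isSquare_algebraMap_of_eval_neg {r : MvPolynomial (Fin 3) ℚ} (v : Fin 3 → ℚ)
    (h : MvPolynomial.eval v r < 0) :
    ¬IsSquare (algebraMap (MvPolynomial (Fin 3) ℚ) RatFuncField r) := fun hr ↦
  h.not_ge (hr.map_of_isSquare_algebraMap (MvPolynomial.eval v)).nonneg

end Generic

/-- The Galois group of the splitting field of `f₁ · f₂` over `ℚ(a, b, n)` is
isomorphic to `S₃ × S₃`; in particular the splitting field has degree 36. -/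
theorem generic_galois_group :
    Nonempty ((genF₁ * genF₂).Gal ≃* Equiv.Perm (Fin 3) × Equiv.Perm (Fin 3)) ∧
      Module.finrank RatFuncField (genF₁ * genF₂).SplittingField = 36 := by
  have h : Nonempty ((genF₁ * genF₂).Gal ≃* Equiv.Perm (Fin 3) × Equiv.Perm (Fin 3)) := by
    have h₁ := irreducible_genF₁
    have h₂ := irreducible_genF₂
    rw [← toPoly_map_cubic₁] at h₁ ⊢
    rw [← toPoly_map_cubic₂] at h₂ ⊢
    apply Cubic.nonempty_gal_mulEquiv_perm_prod _ _ _ _ h₁ h₂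
    · rw [Cubic.map_discr]
      exact not_isSquare_algebraMap_of_eval_neg ![0, 0, -2] (by simp [cubic₁, Cubic.discr])
    · rw [Cubic.map_discr]
      exact not_isSquare_algebraMap_of_eval_neg ![0, 0, -2] (by simp [cubic₂, Cubic.discr])
    · rw [Cubic.map_discr, Cubic.map_discr, ← map_mul]
      exact not_isSquare_algebraMap_of_eval_neg ![-1, 0, 0]
        (by simp [cubic₁, cubic₂, Cubic.discr]; norm_num)
    all_goals simp [Cubic.map, cubic₁, cubic₂]
  refine ⟨h, ?_⟩
  obtain ⟨e⟩ := h
  have : IsGalois RatFuncField (genF₁ * genF₂).SplittingField := { }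
  rw [← IsGalois.card_aut_eq_finrank]
  refine (Nat.card_congr e.toEquiv).trans ?_
  rw [Nat.card_prod, Nat.card_perm, Nat.card_fin]
  rfl
end

section
/- Fix a, b ∈ ℤ with a ≠ 0. Then the set of integers n such that Δ₂(n) := −243·(4a³ + 27(3b − n)²)·(4a³ + 3(3b − n)²) is a square of an integer is finite. -/
/-- For fixed `a b ∈ ℤ` with `a ≠ 0`, the set of integers `n` such that
`Δ₂(n) = −243(4a³ + 27(3b − n)²)(4a³ + 3(3b − n)²)` is a square of an integer is finite. -/
theorem delta2_square_finite (a b : ℤ) (ha : a ≠ 0) :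
    {n : ℤ | ∃ z : ℤ,
      -243 * (4 * a ^ 3 + 27 * (3 * b - n) ^ 2) * (4 * a ^ 3 + 3 * (3 * b - n) ^ 2)
        = z ^ 2}.Finite := by
  refine (Set.finite_Icc (3 * b - |4 * a ^ 3|) (3 * b + |4 * a ^ 3|)).subset ?_
  rintro n ⟨z, hz⟩
  have hle : 4 * a ^ 3 + 3 * (3 * b - n) ^ 2 ≤ 0 := by
    by_contra! hpos
    have hpos' : 0 < 4 * a ^ 3 + 27 * (3 * b - n) ^ 2 := by
      linarith [sq_nonneg (3 * b - n)]
    linarith [mul_pos hpos' hpos, sq_nonneg z]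
  have habs : |3 * b - n| ≤ |4 * a ^ 3| := by
    have hsq : |3 * b - n| ≤ (3 * b - n) ^ 2 := by
      simpa using Int.natAbs_le_self_sq (3 * b - n)
    linarith [neg_le_abs (4 * a ^ 3), sq_nonneg (3 * b - n)]
  rw [abs_le] at habs
  constructor <;> linarith [habs.1, habs.2]
end

section
/- Fix a, b ∈ ℤ with a ≠ 0. Then the set of integers n such that either 4a³ + 27(3b − n)² = 0, or 243·(4a³ + 3(3b − n)²) is a square in ℚ, is finite. -/
/-- An integer `m` whose square differs from a square by the nonzero amount `N`, after scaling
by `c ≠ 0`, is bounded by `|N|`. -/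
lemma abs_le_of_sq_sub_mul_sq_eq {c m y N : ℤ} (hc : c ≠ 0) (hN : N ≠ 0)
    (h : y ^ 2 - (c * m) ^ 2 = N) : |m| ≤ |N| := by
  have hpos : 0 < |N| := abs_pos.mpr hN
  have h₁ : |y + c * m| ≤ |N| :=
    Int.le_of_dvd hpos ((abs_dvd_abs _ _).mpr ⟨y - c * m, by rw [← h]; ring⟩)
  have h₂ : |y - c * m| ≤ |N| :=
    Int.le_of_dvd hpos ((abs_dvd_abs _ _).mpr ⟨y + c * m, by rw [← h]; ring⟩)
  have h₃ : |c * m| ≤ |N| := by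
    rw [abs_le] at h₁ h₂ ⊢
    constructor <;> linarith
  rw [abs_mul] at h₃
  exact (le_mul_of_one_le_left (abs_nonneg m) (Int.one_le_abs hc)).trans h₃

/-- For fixed `a b ∈ ℤ` with `a ≠ 0`, the set of integers `n` such that either
`4a³ + 27(3b − n)² = 0` or `243(4a³ + 3(3b − n)²)` is a square in `ℚ` is finite. -/
theorem delta3_square_finite (a b : ℤ) (ha : a ≠ 0) :
    {n : ℤ | 4 * a ^ 3 + 27 * (3 * b - n) ^ 2 = 0 ∨
      IsSquare ((243 * (4 * a ^ 3 + 3 * (3 * b - n) ^ 2) : ℤ) : ℚ)}.Finite := by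
  have hN : 972 * a ^ 3 ≠ 0 := by positivity
  refine (Set.finite_Icc (3 * b - |972 * a ^ 3|) (3 * b + |972 * a ^ 3|)).subset ?_
  intro n hn
  have hbound : |3 * b - n| ≤ |972 * a ^ 3| := by
    rcases hn with h | h
    · have hsq : |3 * b - n| ≤ (3 * b - n) ^ 2 := by
        rw [Int.abs_eq_natAbs]
        exact Int.natAbs_le_self_sq _
      have := neg_le_abs (972 * a ^ 3)
      nlinarith [sq_nonneg (3 * b - n)]
    · obtain ⟨y, hy⟩ := Rat.isSquare_intCast_iff.mp h
      exact abs_le_of_sq_sub_mul_sq_eq (c := 27) (y := y) (by norm_num) hN (by linarith)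
  rw [abs_le] at hbound
  exact ⟨by linarith, by linarith⟩
end

section
/- Fix a, b ∈ ℚ with a ≠ 0, and let F(t, x, y) = x³ − 12a·x²y + 36a²·xy² + 27y(3by − t)² + 4a³y³, a homogeneous cubic form in the variables t, x, y. Then for every (t, x, y) with coordinates in an algebraic closure of ℚ satisfying F(t,x,y) = 0 and ∂F/∂t (t,x,y) = ∂F/∂x (t,x,y) = ∂F/∂y (t,x,y) = 0, one has t = x = y = 0. (Equivalently, the plane projective cubic curve F = 0 ⊂ ℙ²_ℚ is smooth.) -/
/-- For `a b ∈ ℚ` with `a ≠ 0`, the plane projective cubic curve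
`F(t,x,y) = x³ − 12a x²y + 36a² xy² + 27y(3by − t)² + 4a³y³ = 0 ⊂ ℙ²_ℚ` is smooth:
any common zero over an algebraic closure of `ℚ` of `F` and its three partial derivatives
is trivial. -/
theorem homogenised_f2_curve_smooth (a b : ℚ) (ha : a ≠ 0)
    (t x y : AlgebraicClosure ℚ)
    (hF : x ^ 3 - 12 * algebraMap ℚ (AlgebraicClosure ℚ) a * x ^ 2 * y
      + 36 * (algebraMap ℚ (AlgebraicClosure ℚ) a) ^ 2 * x * y ^ 2
      + 27 * y * (3 * algebraMap ℚ (AlgebraicClosure ℚ) b * y - t) ^ 2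
      + 4 * (algebraMap ℚ (AlgebraicClosure ℚ) a) ^ 3 * y ^ 3 = 0)
    (hFt : -54 * (3 * algebraMap ℚ (AlgebraicClosure ℚ) b * y - t) * y = 0)
    (hFx : 36 * (algebraMap ℚ (AlgebraicClosure ℚ) a) ^ 2 * y ^ 2
      - 24 * algebraMap ℚ (AlgebraicClosure ℚ) a * x * y + 3 * x ^ 2 = 0)
    (hFy : 12 * (algebraMap ℚ (AlgebraicClosure ℚ) a) ^ 3 * y ^ 2
      + 72 * (algebraMap ℚ (AlgebraicClosure ℚ) a) ^ 2 * x * y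
      - 12 * algebraMap ℚ (AlgebraicClosure ℚ) a * x ^ 2
      + 162 * (3 * algebraMap ℚ (AlgebraicClosure ℚ) b * y - t)
          * algebraMap ℚ (AlgebraicClosure ℚ) b * y
      + 27 * (3 * algebraMap ℚ (AlgebraicClosure ℚ) b * y - t) ^ 2 = 0) :
    t = 0 ∧ x = 0 ∧ y = 0 := by
  have hA : algebraMap ℚ (AlgebraicClosure ℚ) a ≠ 0 := by simpa using ha
  generalize algebraMap ℚ (AlgebraicClosure ℚ) a = A at *
  generalize algebraMap ℚ (AlgebraicClosure ℚ) b = B at *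
  by_cases hy : y = 0
  · subst hy
    have hx : x = 0 := by simpa using hFx
    subst hx
    have ht : t = 0 := by simpa using hFy
    exact ⟨ht, rfl, rfl⟩
  · exfalso
    have hu : 3 * B * y - t = 0 := by simpa [hy] using hFt
    rw [hu] at hF
    have hAy : A ^ 3 * y ^ 3 ≠ 0 := mul_ne_zero (pow_ne_zero 3 hA) (pow_ne_zero 3 hy)
    have hfactor : (x - 2 * A * y) * (x - 6 * A * y) = 0 := by
      linear_combination hFx / 3
    apply hAy
    rcases mul_eq_zero.mp hfactor with h | h
    · obtain rfl := sub_eq_zero.mp h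
      linear_combination hF / 36
    · obtain rfl := sub_eq_zero.mp h
      linear_combination hF / 4
end

section
/- Fix a, b ∈ ℤ with a ≠ 0. Then the set of integers n for which at least one of the following holds is finite: (i) Δ₁(n) = −(4a³ + 27(3b−n)²) is a square in ℚ; (ii) Δ₂(n) = −243(4a³+27(3b−n)²)(4a³+3(3b−n)²) is a square in ℚ; (iii) Δ₁(n) = 0 or 243(4a³ + 3(3b−n)²) is a square in ℚ; (iv) the polynomial X³ − 12a·X² + 36a²·X + (27(3b−n)² + 4a³) is reducible in ℚ[X]. -/
open Polynomial

theorem taylor_coeff_eq_sum {R : Type*} [CommRing R] {p : R[X]} {D : ℕ} (hp : p.natDegree ≤ D)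
    (x : R) (k : ℕ) :
    (taylor x p).coeff k =
      ∑ i ∈ Finset.range (D + 1), (i.choose k : R) * p.coeff i * x ^ (i - k) := by
  rw [taylor_coeff, hasseDeriv_apply,
    p.sum_over_range' (by simp) (D + 1) (Nat.lt_succ_of_le hp), eval_finsetSum]
  simp [eval_monomial]

theorem X_sub_C_pow_dvd_iff_taylor_coeff {R : Type*} [CommRing R] {p : R[X]} {x : R} {n : ℕ} :
    (X - C x) ^ n ∣ p ↔ ∀ k < n, (taylor x p).coeff k = 0 := by
  rw [X_sub_C_pow_dvd_iff, ← taylor_apply, X_pow_dvd_iff]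

theorem abs_taylor_coeff_le {p : ℝ[X]} {D : ℕ} (hp : p.natDegree ≤ D) {x R T : ℝ} (hR : 1 ≤ R)
    (hx : |x| ≤ R) (hT : ∀ i, |p.coeff i| ≤ T) (k : ℕ) :
    |(taylor x p).coeff k| ≤ (D + 1) * 2 ^ D * T * R ^ D := by
  rw [taylor_coeff_eq_sum hp]
  refine (Finset.abs_sum_le_sum_abs _ _).trans ?_
  have hT0 : 0 ≤ T := (abs_nonneg _).trans (hT 0)
  have : ∀ i ∈ Finset.range (D + 1),
      |(i.choose k : ℝ) * p.coeff i * x ^ (i - k)| ≤ 2 ^ D * T * R ^ D := by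
    intro i hi
    have hi' : i ≤ D := Nat.lt_succ_iff.mp (Finset.mem_range.mp hi)
    rw [abs_mul, abs_mul, abs_pow, Nat.abs_cast]
    have h1 : (i.choose k : ℝ) ≤ 2 ^ D := by
      exact_mod_cast (Nat.choose_le_two_pow i k).trans (Nat.pow_le_pow_right (by norm_num) hi')
    have h2 : |x| ^ (i - k) ≤ R ^ D :=
      (pow_le_pow_left₀ (abs_nonneg _) hx _).trans (pow_le_pow_right₀ hR (by omega))
    gcongr
    exact hT i
  refine (Finset.sum_le_sum this).trans_eq ?_
  simp
  ring

theorem abs_taylor_coeff_le_of_coeff_eq_zero {p : ℝ[X]} {D : ℕ} (hp : p.natDegree ≤ D) {x T : ℝ}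
    (hx : |x| ≤ 1) (hT : ∀ i, |p.coeff i| ≤ T) {m : ℕ} (hm : ∀ i < m, p.coeff i = 0) (k : ℕ) :
    |(taylor x p).coeff k| ≤ (D + 1) * 2 ^ D * T * |x| ^ (m - k) := by
  rw [taylor_coeff_eq_sum hp]
  refine (Finset.abs_sum_le_sum_abs _ _).trans ?_
  have hT0 : 0 ≤ T := (abs_nonneg _).trans (hT 0)
  have : ∀ i ∈ Finset.range (D + 1),
      |(i.choose k : ℝ) * p.coeff i * x ^ (i - k)| ≤ 2 ^ D * T * |x| ^ (m - k) := by
    intro i hi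
    have hi' : i ≤ D := Nat.lt_succ_iff.mp (Finset.mem_range.mp hi)
    rcases lt_or_ge i m with him | him
    · rw [hm i him]
      simp only [mul_zero, zero_mul, abs_zero]
      positivity
    rw [abs_mul, abs_mul, abs_pow, Nat.abs_cast]
    have h1 : (i.choose k : ℝ) ≤ 2 ^ D := by
      exact_mod_cast (Nat.choose_le_two_pow i k).trans (Nat.pow_le_pow_right (by norm_num) hi')
    have h2 : |x| ^ (i - k) ≤ |x| ^ (m - k) :=
      pow_le_pow_of_le_one (abs_nonneg _) hx (by omega)
    gcongr
    exact hT i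
  refine (Finset.sum_le_sum this).trans_eq ?_
  simp
  ring

/-- The powers of a root of a monic integer quartic have integer coordinates of at most
exponential size. -/
theorem exists_pow_eq_sum_of_root {α : ℝ} {c : Fin 4 → ℤ}
    (h : α ^ 4 = ∑ l, (c l : ℝ) * α ^ (l : ℕ)) :
    ∃ (r : ℕ → Fin 4 → ℤ) (ρ : ℝ), 1 ≤ ρ ∧ (∀ j, α ^ j = ∑ l, (r j l : ℝ) * α ^ (l : ℕ)) ∧
      ∀ j l, |(r j l : ℝ)| ≤ ρ ^ j := by
  set H : ℝ := ∑ l, |(c l : ℝ)| with hH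
  have hH0 : 0 ≤ H := Finset.sum_nonneg fun _ _ => abs_nonneg _
  have hc : ∀ l, |(c l : ℝ)| ≤ H := fun l =>
    Finset.single_le_sum (f := fun l => |(c l : ℝ)|) (fun _ _ => abs_nonneg _) (Finset.mem_univ l)
  obtain ⟨r, hr0, hr⟩ : ∃ r : ℕ → Fin 4 → ℤ, r 0 = ![1, 0, 0, 0] ∧
      ∀ j, r (j + 1) = ![r j 3 * c 0, r j 0 + r j 3 * c 1, r j 1 + r j 3 * c 2,
        r j 2 + r j 3 * c 3] :=
    ⟨fun j => Nat.rec ![1, 0, 0, 0]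
      (fun _ v => ![v 3 * c 0, v 0 + v 3 * c 1, v 1 + v 3 * c 2, v 2 + v 3 * c 3]) j,
      rfl, fun _ => rfl⟩
  refine ⟨r, 1 + H, by linarith, ?_, ?_⟩
  · intro j
    induction j with
    | zero => simp [hr0, Fin.sum_univ_four]
    | succ j ih =>
      rw [pow_succ, ih, hr]
      simp only [Fin.sum_univ_four] at h ⊢
      simp at h ⊢
      linear_combination (r j 3 : ℝ) * h
  · intro j
    induction j with
    | zero => intro l; fin_cases l <;> simp [hr0]
    | succ j ih =>
      have hρ : 0 ≤ (1 + H) ^ j := by positivity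
      have h3 : ∀ l, |(r j 3 : ℝ) * c l| ≤ (1 + H) ^ j * H := fun l => by
        rw [abs_mul]; exact mul_le_mul (ih 3) (hc l) (abs_nonneg _) hρ
      intro l
      rw [hr, pow_succ]
      have e : ∀ a b, |(r j a : ℝ) + r j 3 * c b| ≤ (1 + H) ^ j * (1 + H) := fun a b => by
        refine (abs_add_le _ _).trans ?_
        linarith [ih a, h3 b]
      fin_cases l
      · simp
        have := h3 0
        rw [abs_mul] at this
        linarith
      · simpa using e 0 1
      · simpa using e 1 2
      · simpa using e 2 3

section SiegelLemma

attribute [local instance] Matrix.seminormedAddCommGroup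

/-- Thue's auxiliary polynomial `P + Y Q`, vanishing to high order at `(α, α)` in the first
variable. -/
theorem exists_auxiliary_polynomial {α : ℝ} {c : Fin 4 → ℤ}
    (h : α ^ 4 = ∑ l, (c l : ℝ) * α ^ (l : ℕ)) :
    ∃ B : ℝ, 1 ≤ B ∧ ∀ M : ℕ, 1 ≤ M → ∃ P Q : ℤ[X],
      P.natDegree ≤ 33 * M ∧ Q.natDegree ≤ 33 * M ∧ (P ≠ 0 ∨ Q ≠ 0) ∧
      (∀ i, |(P.coeff i : ℝ)| ≤ B ^ M) ∧ (∀ i, |(Q.coeff i : ℝ)| ≤ B ^ M) ∧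
      (X - C α) ^ (16 * M) ∣
        P.map (Int.castRingHom ℝ) + C α * Q.map (Int.castRingHom ℝ) := by
  obtain ⟨r, ρ, hρ, hr, hrρ⟩ := exists_pow_eq_sum_of_root h
  refine ⟨(136 * 2 ^ 33 * ρ ^ 34) ^ 32, ?_, fun M hM => ?_⟩
  · have : 1 ≤ ρ ^ 34 := one_le_pow₀ hρ
    refine one_le_pow₀ ?_
    linarith
  set D := 33 * M with hD
  let A : Matrix (Fin (16 * M) × Fin 4) (Fin (D + 1) ⊕ Fin (D + 1)) ℤ := fun kl s =>
    Sum.elim (fun i : Fin (D + 1) => ((i : ℕ).choose kl.1 : ℤ) * r (i - kl.1) kl.2)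
      (fun i : Fin (D + 1) => ((i : ℕ).choose kl.1 : ℤ) * r (i - kl.1 + 1) kl.2) s
  have hcardα : Fintype.card (Fin (16 * M) × Fin 4) = 64 * M := by simp; ring
  have hcardβ : Fintype.card (Fin (D + 1) ⊕ Fin (D + 1)) = 66 * M + 2 := by simp; omega
  obtain ⟨t, ht0, hAt, htn⟩ := Int.Matrix.exists_ne_zero_int_vec_norm_le A
    (by rw [hcardα, hcardβ]; omega) (by rw [hcardα]; omega)
  have hA : ‖A‖ ≤ 2 ^ D * ρ ^ (D + 1) := by
    rw [Matrix.norm_le_iff (by positivity)]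
    have key : ∀ (i k j : ℕ) (l : Fin 4), i ≤ D → j ≤ D + 1 →
        ‖((i.choose k : ℤ) * r j l)‖ ≤ 2 ^ D * ρ ^ (D + 1) := by
      intro i k j l hi hj
      rw [Int.norm_eq_abs]
      push_cast
      rw [abs_mul, Nat.abs_cast]
      have h1 : (i.choose k : ℝ) ≤ 2 ^ D := by
        exact_mod_cast (Nat.choose_le_two_pow i k).trans (Nat.pow_le_pow_right (by norm_num) hi)
      have h2 : |(r j l : ℝ)| ≤ ρ ^ (D + 1) := (hrρ j l).trans (pow_le_pow_right₀ hρ hj)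
      gcongr
    rintro ⟨k, l⟩ (i | i)
    · exact key i k _ l (by omega) (by omega)
    · exact key i k _ l (by omega) (by omega)
  have hbound : ‖t‖ ≤ ((136 * 2 ^ 33 * ρ ^ 34) ^ 32) ^ M := by
    refine htn.trans ?_
    rw [hcardα, hcardβ]
    have hb : ((66 * M + 2 : ℕ) : ℝ) * max 1 ‖A‖ ≤ (136 * 2 ^ 33 * ρ ^ 34) ^ M := by
      have hmax : max 1 ‖A‖ ≤ 2 ^ D * ρ ^ (D + 1) :=
        max_le (one_le_mul_of_one_le_of_one_le (one_le_pow₀ (by norm_num)) (one_le_pow₀ hρ)) hA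
      have h66 : ((66 * M + 2 : ℕ) : ℝ) ≤ 136 ^ M := by
        have h2 : 66 * M + 2 ≤ 136 ^ M := by
          clear * - hM
          induction M, hM using Nat.le_induction with
          | base => norm_num
          | succ n hn ih => rw [pow_succ]; omega
        exact_mod_cast h2
      calc ((66 * M + 2 : ℕ) : ℝ) * max 1 ‖A‖ ≤ 136 ^ M * (2 ^ D * ρ ^ (D + 1)) := by gcongr
        _ ≤ 136 ^ M * (2 ^ D * ρ ^ (34 * M)) := by
            gcongr
            omega
        _ = (136 * 2 ^ 33 * ρ ^ 34) ^ M := by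
            rw [mul_pow, mul_pow, hD, pow_mul, pow_mul]; ring
    have hb1 : 1 ≤ ((66 * M + 2 : ℕ) : ℝ) * max 1 ‖A‖ :=
      one_le_mul_of_one_le_of_one_le (by push_cast; linarith [(Nat.cast_nonneg M : (0 : ℝ) ≤ M)])
        (le_max_left _ _)
    have hexp : ((64 * M : ℕ) : ℝ) / (((66 * M + 2 : ℕ) : ℝ) - ((64 * M : ℕ) : ℝ)) ≤ (32 : ℕ) := by
      have : (0 : ℝ) ≤ M := Nat.cast_nonneg M
      push_cast
      rw [div_le_iff₀ (by linarith)]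
      linarith
    refine (Real.rpow_le_rpow_of_exponent_le hb1 hexp).trans ?_
    rw [Real.rpow_natCast, ← pow_mul, mul_comm 32 M, pow_mul]
    gcongr
  have hcoe : ∀ s, |(t s : ℝ)| ≤ ((136 * 2 ^ 33 * ρ ^ 34) ^ 32) ^ M := fun s => by
    rw [← Int.norm_eq_abs]
    exact (norm_le_pi_norm t s).trans hbound
  let P : ℤ[X] := ∑ i : Fin (D + 1), monomial (i : ℕ) (t (Sum.inl i))
  let Q : ℤ[X] := ∑ i : Fin (D + 1), monomial (i : ℕ) (t (Sum.inr i))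
  have hcoeff : ∀ (s : Fin (D + 1) → ℤ) (j : ℕ),
      (∑ i : Fin (D + 1), monomial (i : ℕ) (s i)).coeff j =
        if hj : j < D + 1 then s ⟨j, hj⟩ else 0 := by
    intro s j
    rw [finsetSum_coeff]
    simp only [coeff_monomial]
    split_ifs with hj
    · rw [Finset.sum_eq_single ⟨j, hj⟩]
      · simp
      · rintro ⟨b, hb⟩ - hne
        rw [if_neg]
        rintro rfl
        exact hne rfl
      · simp
    · refine Finset.sum_eq_zero fun i _ => if_neg ?_
      omega
  have hdeg : ∀ s : Fin (D + 1) → ℤ,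
      (∑ i : Fin (D + 1), monomial (i : ℕ) (s i)).natDegree ≤ D := fun s =>
    natDegree_sum_le_of_forall_le _ _ fun i _ =>
      (natDegree_monomial_le _).trans (Nat.lt_succ_iff.mp i.2)
  have hsmall : ∀ (f : Fin (D + 1) → Fin (D + 1) ⊕ Fin (D + 1)) (j : ℕ),
      |((∑ i : Fin (D + 1), monomial (i : ℕ) (t (f i))).coeff j : ℝ)| ≤
        ((136 * 2 ^ 33 * ρ ^ 34) ^ 32) ^ M := by
    intro f j
    rw [hcoeff (fun i => t (f i))]
    split_ifs with hj
    · exact hcoe _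
    · simp only [Int.cast_zero, abs_zero]; positivity
  refine ⟨P, Q, hdeg _, hdeg _, ?_, hsmall _, hsmall _, ?_⟩
  · by_contra! hPQ
    refine ht0 (funext fun s => ?_)
    rcases s with i | i
    · have := hcoeff (fun i => t (Sum.inl i)) i
      rw [show (∑ i : Fin (D + 1), monomial (i : ℕ) (t (Sum.inl i))) = 0 from hPQ.1] at this
      simpa [Nat.lt_succ_iff.mp i.2] using this.symm
    · have := hcoeff (fun i => t (Sum.inr i)) i
      rw [show (∑ i : Fin (D + 1), monomial (i : ℕ) (t (Sum.inr i))) = 0 from hPQ.2] at this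
      simpa [Nat.lt_succ_iff.mp i.2] using this.symm
  · rw [X_sub_C_pow_dvd_iff_taylor_coeff]
    intro k hk
    have hmon : ∀ (i : ℕ) (a : ℝ),
        (taylor α (monomial i a)).coeff k = a * (i.choose k : ℝ) * α ^ (i - k) := by
      intro i a
      rw [taylor_coeff, hasseDeriv_monomial, eval_monomial]
      ring
    have hrow : ∀ l : Fin 4,
        ∑ i : Fin (D + 1), ((i : ℕ).choose k : ℝ) * r (i - k) l * t (Sum.inl i) +
        ∑ i : Fin (D + 1), ((i : ℕ).choose k : ℝ) * r (i - k + 1) l * t (Sum.inr i) = 0 := by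
      intro l
      have := congrFun hAt (⟨k, hk⟩, l)
      simp only [Matrix.mulVec, dotProduct, Fintype.sum_sum_type, A, Sum.elim_inl,
        Sum.elim_inr, Pi.zero_apply] at this
      exact_mod_cast this
    have hC : ∀ p : ℝ[X], (taylor α (C α * p)).coeff k = α * (taylor α p).coeff k := by
      intro p
      rw [taylor_mul, taylor_C, coeff_C_mul]
    rw [map_add, coeff_add, hC]
    simp only [P, Q, Polynomial.map_sum, map_monomial, map_sum, finsetSum_coeff, hmon,
      eq_intCast]
    have e1 : ∀ i : Fin (D + 1), ((t (Sum.inl i) : ℤ) : ℝ) * ((i : ℕ).choose k : ℝ) * α ^ (i - k : ℕ)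
        = ∑ l : Fin 4, (((i : ℕ).choose k : ℝ) * r (i - k) l * t (Sum.inl i)) * α ^ (l : ℕ) := by
      intro i
      rw [hr (i - k), Finset.mul_sum]
      exact Finset.sum_congr rfl fun l _ => by ring
    have e2 : ∀ i : Fin (D + 1),
        α * (((t (Sum.inr i) : ℤ) : ℝ) * ((i : ℕ).choose k : ℝ) * α ^ (i - k : ℕ))
        = ∑ l : Fin 4, (((i : ℕ).choose k : ℝ) * r (i - k + 1) l * t (Sum.inr i)) * α ^ (l : ℕ) := by
      intro i
      rw [show α * (((t (Sum.inr i) : ℤ) : ℝ) * ((i : ℕ).choose k : ℝ) * α ^ (i - k : ℕ)) =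
        (t (Sum.inr i) : ℝ) * ((i : ℕ).choose k : ℝ) * α ^ (i - k + 1 : ℕ) by ring,
        hr (i - k + 1), Finset.mul_sum]
      exact Finset.sum_congr rfl fun l _ => by ring
    rw [Finset.mul_sum, Finset.sum_congr rfl fun i _ => e1 i, Finset.sum_congr rfl fun i _ => e2 i,
      Finset.sum_comm, Finset.sum_comm (s := Finset.univ (α := Fin (D + 1))),
      ← Finset.sum_add_distrib]
    refine Finset.sum_eq_zero fun l _ => ?_
    rw [← Finset.sum_mul, ← Finset.sum_mul, ← add_mul, hrow l, zero_mul]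

end SiegelLemma

theorem pow_dvd_wronskian {R : Type*} [CommRing R] {P Q : R[X]} {x y : R} {n : ℕ}
    (h : (X - C x) ^ n ∣ P + C y * Q) : (X - C x) ^ (n - 1) ∣ wronskian P Q := by
  have hW : wronskian P Q =
      (P + C y * Q) * derivative Q - derivative (P + C y * Q) * Q := by
    simp only [wronskian, derivative_add, derivative_mul, derivative_C]
    ring
  rw [hW]
  exact dvd_sub (((pow_dvd_pow _ (Nat.sub_le n 1)).trans h).mul_right _)
    ((pow_sub_one_dvd_derivative_of_pow_dvd h).mul_right _)

theorem minpoly_pow_dvd {α : ℝ} (hα : IsIntegral ℚ α) (j : ℕ) :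
    ∀ W : ℚ[X], (X - C α) ^ j ∣ W.map (algebraMap ℚ ℝ) → minpoly ℚ α ^ j ∣ W := by
  obtain ⟨h, hh⟩ : X - C α ∣ (minpoly ℚ α).map (algebraMap ℚ ℝ) := by
    rw [dvd_iff_isRoot, IsRoot.def, eval_map_algebraMap]
    exact minpoly.aeval ℚ α
  have hsep : ((minpoly ℚ α).map (algebraMap ℚ ℝ)).Separable :=
    (minpoly.irreducible hα).separable.map
  have hcop : IsCoprime (X - C α) h := by
    rw [hh] at hsep
    exact hsep.isCoprime
  induction j with
  | zero => intro W _; simp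
  | succ j ih =>
    intro W hW
    have hroot : aeval α W = 0 := by
      rw [← eval_map_algebraMap, ← IsRoot.def, ← dvd_iff_isRoot]
      exact (dvd_pow_self _ (Nat.succ_ne_zero j)).trans hW
    obtain ⟨V, rfl⟩ := minpoly.dvd ℚ α hroot
    rw [Polynomial.map_mul, hh, pow_succ', mul_assoc] at hW
    have hW' := (mul_dvd_mul_iff_left (X_sub_C_ne_zero α)).mp hW
    rw [pow_succ']
    exact mul_dvd_mul_left _ (ih V (hcop.pow_left.dvd_of_dvd_mul_left hW'))

/-- If `P / Q` is constant, then `P + α Q` cannot vanish to high order at `α`. -/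
theorem wronskian_ne_zero_of_pow_dvd {α : ℝ} (hα : IsIntegral ℚ α) (hαQ : Irrational α)
    {P Q : ℚ[X]} {D n : ℕ} (hP : P.natDegree ≤ D) (hQ : Q.natDegree ≤ D) (hPQ : P ≠ 0 ∨ Q ≠ 0)
    (hD : D < n * (minpoly ℚ α).natDegree)
    (h : (X - C α) ^ n ∣ P.map (algebraMap ℚ ℝ) + C α * Q.map (algebraMap ℚ ℝ)) :
    wronskian P Q ≠ 0 := by
  intro hW
  have hg0 : gcd P Q ≠ 0 := by
    rw [Ne, gcd_eq_zero_iff]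
    tauto
  obtain ⟨P₀, Q₀, hcop, hP₀, hQ₀⟩ : ∃ P₀ Q₀ : ℚ[X], IsCoprime P₀ Q₀ ∧
      P = gcd P Q * P₀ ∧ Q = gcd P Q * Q₀ := by
    obtain ⟨P₀, Q₀, h1, h2, hu⟩ := extract_gcd P Q
    exact ⟨P₀, Q₀, (gcd_isUnit_iff _ _).mp hu, h1, h2⟩
  set g := gcd P Q
  have hW₀ : wronskian P₀ Q₀ = 0 := by
    have : wronskian P Q = g ^ 2 * wronskian P₀ Q₀ := by
      rw [hP₀, hQ₀]
      simp only [wronskian, derivative_mul]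
      ring
    rw [hW] at this
    exact (mul_eq_zero.mp this.symm).resolve_left (pow_ne_zero 2 hg0)
  obtain ⟨hdP, hdQ⟩ := hcop.wronskian_eq_zero_iff.mp hW₀
  obtain ⟨a, ha⟩ : ∃ a, P₀ = C a := ⟨_, eq_C_of_derivative_eq_zero hdP⟩
  obtain ⟨b, hb⟩ : ∃ b, Q₀ = C b := ⟨_, eq_C_of_derivative_eq_zero hdQ⟩
  have hab : (a : ℝ) + α * b ≠ 0 := by
    intro h0
    rcases eq_or_ne b 0 with rfl | hb0
    · have : a = 0 := by simpa using h0
      subst this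
      rw [ha, hb, C_0] at hcop
      exact not_isCoprime_zero_zero hcop
    · refine hαQ ⟨-a / b, ?_⟩
      have : (b : ℝ) ≠ 0 := by exact_mod_cast hb0
      push_cast
      field_simp
      linarith
  have hdvd : (X - C α) ^ n ∣ g.map (algebraMap ℚ ℝ) := by
    have : P.map (algebraMap ℚ ℝ) + C α * Q.map (algebraMap ℚ ℝ) =
        g.map (algebraMap ℚ ℝ) * C ((a : ℝ) + α * b) := by
      rw [hP₀, hQ₀, ha, hb]
      simp only [Polynomial.map_mul, map_C, eq_ratCast, C_add, C_mul]
      ring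
    rw [this] at h
    exact (isUnit_C.mpr (isUnit_iff_ne_zero.mpr hab)).dvd_mul_right.mp h
  have hle := natDegree_le_of_dvd (minpoly_pow_dvd hα n g hdvd) hg0
  rw [natDegree_pow] at hle
  have : g.natDegree ≤ D := by
    rcases hPQ with h0 | h0
    · exact (natDegree_le_of_dvd (gcd_dvd_left P Q) h0).trans hP
    · exact (natDegree_le_of_dvd (gcd_dvd_right P Q) h0).trans hQ
  omega

theorem exists_taylor_coeff_ne_zero {α : ℝ} (hα : IsIntegral ℚ α)
    (hdeg : (minpoly ℚ α).natDegree = 4) {P Q : ℚ[X]} {M : ℕ} (hM : 5 ≤ M)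
    (hP : P.natDegree ≤ 33 * M) (hQ : Q.natDegree ≤ 33 * M) (hPQ : P ≠ 0 ∨ Q ≠ 0)
    (h : (X - C α) ^ (16 * M) ∣ P.map (algebraMap ℚ ℝ) + C α * Q.map (algebraMap ℚ ℝ))
    (x y : ℚ) : ∃ k ≤ 3 * M, (taylor x (P + C y * Q)).coeff k ≠ 0 := by
  by_contra! hk
  have hαQ : Irrational α := by
    rintro ⟨q, rfl⟩
    rw [← eq_ratCast (algebraMap ℚ ℝ), minpoly.eq_X_sub_C, natDegree_X_sub_C] at hdeg
    omega
  have hW := wronskian_ne_zero_of_pow_dvd hα hαQ hP hQ hPQ (by rw [hdeg]; omega) h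
  have h1 : minpoly ℚ α ^ (16 * M - 1) ∣ wronskian P Q := by
    refine minpoly_pow_dvd hα _ _ ?_
    have := pow_dvd_wronskian h
    rwa [show wronskian (P.map (algebraMap ℚ ℝ)) (Q.map (algebraMap ℚ ℝ)) =
      (wronskian P Q).map (algebraMap ℚ ℝ) by simp [wronskian, derivative_map]] at this
  have h2 : (X - C x) ^ (3 * M) ∣ wronskian P Q :=
    pow_dvd_wronskian (n := 3 * M + 1)
      (X_sub_C_pow_dvd_iff_taylor_coeff.mpr fun k hk' => hk k (by omega))
  have hcop : IsCoprime (minpoly ℚ α) (X - C x) := by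
    rw [(minpoly.irreducible hα).coprime_iff_not_dvd]
    intro hd
    have := natDegree_le_of_dvd hd (X_sub_C_ne_zero x)
    rw [hdeg, natDegree_X_sub_C] at this
    omega
  have h3 := natDegree_le_of_dvd (hcop.pow.mul_dvd h1 h2) hW
  have h4 := natDegree_wronskian_lt_add hW
  have h5 : (minpoly ℚ α).Monic := minpoly.monic hα
  rw [(h5.pow _).natDegree_mul ((monic_X_sub_C x).pow _), natDegree_pow, natDegree_pow, hdeg,
    natDegree_X_sub_C] at h3
  omega

/-- Clearing denominators in the Taylor coefficients of `P + y Q`. -/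
theorem exists_int_eq_mul_taylor_coeff {P Q : ℤ[X]} {D : ℕ} (hP : P.natDegree ≤ D)
    (hQ : Q.natDegree ≤ D) (p₁ p₂ : ℤ) {q₁ q₂ : ℕ} (h₁ : 0 < q₁) (h₂ : 0 < q₂) (k : ℕ) :
    ∃ N : ℤ, (N : ℚ) = (q₁ : ℚ) ^ D * q₂ *
      (taylor ((p₁ : ℚ) / q₁) (P.map (Int.castRingHom ℚ) +
        C ((p₂ : ℚ) / q₂) * Q.map (Int.castRingHom ℚ))).coeff k := by
  have hq₁ : (q₁ : ℚ) ≠ 0 := by positivity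
  have hq₂ : (q₂ : ℚ) ≠ 0 := by positivity
  have hdeg : (P.map (Int.castRingHom ℚ) +
      C ((p₂ : ℚ) / q₂) * Q.map (Int.castRingHom ℚ)).natDegree ≤ D :=
    natDegree_add_le_of_degree_le (natDegree_map_le.trans hP)
      ((natDegree_C_mul_le _ _).trans (natDegree_map_le.trans hQ))
  refine ⟨∑ i ∈ Finset.range (D + 1), (i.choose k : ℤ) *
    (q₂ * P.coeff i + p₂ * Q.coeff i) * (p₁ ^ (i - k) * q₁ ^ (D - (i - k))), ?_⟩
  rw [taylor_coeff_eq_sum hdeg]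
  push_cast
  rw [Finset.mul_sum]
  refine Finset.sum_congr rfl fun i hi => ?_
  have hi' : i - k ≤ D := by have := Finset.mem_range.mp hi; omega
  simp only [coeff_add, coeff_C_mul, coeff_map, eq_intCast]
  rw [show (q₁ : ℚ) ^ D = q₁ ^ (D - (i - k)) * q₁ ^ (i - k) by rw [← pow_add]; congr 1; omega,
    div_pow]
  field_simp

/-- Thue's gap principle for two very good rational approximations to a quartic irrationality. -/
theorem exists_thue_gap {α : ℝ} {c : Fin 4 → ℤ} (h : α ^ 4 = ∑ l, (c l : ℝ) * α ^ (l : ℕ))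
    (hdeg : (minpoly ℚ α).natDegree = 4) {K : ℝ} (hK : 1 ≤ K) :
    ∃ E : ℝ, 1 ≤ E ∧ ∀ (p₁ p₂ : ℤ) (q₁ q₂ M : ℕ), 0 < q₁ → 0 < q₂ → 5 ≤ M →
      K ≤ (q₁ : ℝ) ^ 4 → |α - p₁ / q₁| ≤ K / q₁ ^ 4 → |α - p₂ / q₂| ≤ K / q₂ ^ 4 →
      (q₁ : ℝ) ^ (19 * M) ≤ E ^ M * q₂ ∨ (q₂ : ℝ) ^ 3 ≤ E ^ M * q₁ ^ (33 * M) := by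
  have hint : IsIntegral ℚ α := by
    by_contra hα
    rw [minpoly.eq_zero hα] at hdeg
    simp at hdeg
  obtain ⟨B, hB, haux⟩ := exists_auxiliary_polynomial h
  set R : ℝ := |α| + 1 with hRdef
  have hR : 1 ≤ R := by linarith [abs_nonneg α]
  set u : ℝ := 34 * 2 ^ 33 with hu
  have hE0 : 1 ≤ u ^ 2 * B * R ^ 34 * K ^ 13 := by
    have hu1 : 1 ≤ u := by norm_num [hu]
    have h1 := one_le_pow₀ hR (n := 34)
    have h2 := one_le_pow₀ hK (n := 13)
    have h3 := one_le_pow₀ hu1 (n := 2)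
    exact one_le_mul_of_one_le_of_one_le (one_le_mul_of_one_le_of_one_le
      (one_le_mul_of_one_le_of_one_le h3 hB) h1) h2
  set E₁ : ℝ := u ^ 2 * B * R ^ 34 * K ^ 13 with hE₁
  refine ⟨2 * E₁, by linarith, fun p₁ p₂ q₁ q₂ M hq₁ hq₂ hM hKq h₁ h₂ => ?_⟩
  have hq₁' : (0 : ℝ) < q₁ := by exact_mod_cast hq₁
  have hq₂' : (0 : ℝ) < q₂ := by exact_mod_cast hq₂
  obtain ⟨P, Q, hP, hQ, hPQ, hPB, hQB, hdvd⟩ := haux M (by omega)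
  set D := 33 * M with hD
  have hinj : Function.Injective (Int.castRingHom ℚ) := Int.cast_injective
  have hmapmap : ∀ p : ℤ[X], (p.map (Int.castRingHom ℚ)).map (algebraMap ℚ ℝ) =
      p.map (Int.castRingHom ℝ) := fun p => by
    rw [Polynomial.map_map]; congr 1
  obtain ⟨k, hk, hk0⟩ := exists_taylor_coeff_ne_zero hint hdeg hM
    (P := P.map (Int.castRingHom ℚ)) (Q := Q.map (Int.castRingHom ℚ))
    (natDegree_map_le.trans hP) (natDegree_map_le.trans hQ)
    (hPQ.imp (Polynomial.map_ne_zero_iff hinj).mpr (Polynomial.map_ne_zero_iff hinj).mpr)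
    (by rwa [hmapmap, hmapmap]) ((p₁ : ℚ) / q₁) ((p₂ : ℚ) / q₂)
  obtain ⟨N, hN⟩ := exists_int_eq_mul_taylor_coeff hP hQ p₁ p₂ hq₁ hq₂ k
  set x₁ : ℝ := p₁ / q₁ with hx₁
  set x₂ : ℝ := p₂ / q₂ with hx₂
  set PR := P.map (Int.castRingHom ℝ) with hPR
  set QR := Q.map (Int.castRingHom ℝ) with hQR
  set G := PR + C α * QR with hG
  set v : ℝ := (taylor x₁ (PR + C x₂ * QR)).coeff k with hv
  have hNv : (N : ℝ) = (q₁ : ℝ) ^ D * q₂ * v := by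
    have e : v = ((taylor ((p₁ : ℚ) / q₁) (P.map (Int.castRingHom ℚ) +
        C ((p₂ : ℚ) / q₂) * Q.map (Int.castRingHom ℚ))).coeff k : ℚ) := by
      rw [hv, ← eq_ratCast (algebraMap ℚ ℝ), ← coeff_map, map_taylor, Polynomial.map_add,
        Polynomial.map_mul, map_C, hmapmap, hmapmap]
      simp [hx₁, hx₂, hPR, hQR]
    rw [e]
    exact_mod_cast congrArg (fun z : ℚ => (z : ℝ)) hN
  have hN1 : (1 : ℝ) ≤ |(N : ℝ)| := by
    have : N ≠ 0 := by
      rintro rfl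
      have hq₁'' : (q₁ : ℚ) ≠ 0 := by positivity
      have hq₂'' : (q₂ : ℚ) ≠ 0 := by positivity
      rw [Int.cast_zero, eq_comm] at hN
      exact mul_ne_zero (mul_ne_zero (pow_ne_zero _ hq₁'') hq₂'') hk0 hN
    exact_mod_cast Int.one_le_abs this
  have hPRd : PR.natDegree ≤ D := natDegree_map_le.trans hP
  have hQRd : QR.natDegree ≤ D := natDegree_map_le.trans hQ
  have hGd : G.natDegree ≤ D :=
    natDegree_add_le_of_degree_le hPRd ((natDegree_C_mul_le _ _).trans hQRd)
  have hGB : ∀ i, |G.coeff i| ≤ B ^ M * R := fun i => by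
    rw [hG, coeff_add, coeff_C_mul, hPR, hQR, coeff_map, coeff_map]
    refine (abs_add_le _ _).trans ?_
    rw [abs_mul, hRdef, mul_add, mul_one, add_comm, mul_comm |α|]
    exact add_le_add (mul_le_mul_of_nonneg_right (hQB i) (abs_nonneg α)) (hPB i)
  have hU : ((D : ℝ) + 1) * 2 ^ D ≤ u ^ M := by
    have h34 : D + 1 ≤ 34 ^ M := by
      have : ∀ n : ℕ, 33 * n + 1 ≤ 34 ^ n := fun n => by
        induction n with
        | zero => norm_num
        | succ n ih => rw [pow_succ]; omega
      exact this M
    rw [hu, mul_pow, ← pow_mul]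
    gcongr
    exact_mod_cast h34
  have hd₁ : |x₁ - α| ≤ K / q₁ ^ 4 := by rwa [abs_sub_comm]
  have hd₁' : |x₁ - α| ≤ 1 := hd₁.trans ((div_le_one (by positivity)).mpr hKq)
  have hx₁R : |x₁| ≤ R := by
    have := abs_add_le (x₁ - α) α
    rw [sub_add_cancel] at this
    linarith
  have hsplit : v = (taylor (x₁ - α) (taylor α G)).coeff k + (x₂ - α) * (taylor x₁ QR).coeff k := by
    rw [taylor_taylor, sub_add_cancel, hv, hG]
    simp only [map_add, taylor_mul, taylor_C, coeff_add, coeff_C_mul]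
    ring
  have hB0 : 0 ≤ B := by linarith
  have hR0 : 0 ≤ R := by linarith
  have hK0 : 0 ≤ K := by linarith
  have hfirst : |(taylor (x₁ - α) (taylor α G)).coeff k| ≤
      E₁ ^ M / q₁ ^ (52 * M) := by
    refine (abs_taylor_coeff_le_of_coeff_eq_zero (D := D) (by rwa [natDegree_taylor]) hd₁'
      (abs_taylor_coeff_le hGd hR (by linarith) hGB)
      (X_sub_C_pow_dvd_iff_taylor_coeff.mp hdvd) k).trans ?_
    have e1 : |x₁ - α| ^ (16 * M - k) ≤ (K / q₁ ^ 4) ^ (13 * M) :=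
      (pow_le_pow_of_le_one (abs_nonneg _) hd₁' (by omega)).trans
        (pow_le_pow_left₀ (abs_nonneg _) hd₁ _)
    have e2 : R * R ^ D ≤ R ^ (34 * M) := by
      rw [← pow_succ']; exact pow_le_pow_right₀ hR (by omega)
    calc ((D : ℝ) + 1) * 2 ^ D * (((D : ℝ) + 1) * 2 ^ D * (B ^ M * R) * R ^ D) *
          |x₁ - α| ^ (16 * M - k)
        = (((D : ℝ) + 1) * 2 ^ D) * (((D : ℝ) + 1) * 2 ^ D) * B ^ M * (R * R ^ D) *
          |x₁ - α| ^ (16 * M - k) := by ring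
      _ ≤ u ^ M * u ^ M * B ^ M * R ^ (34 * M) * (K / q₁ ^ 4) ^ (13 * M) := by gcongr
      _ = E₁ ^ M / q₁ ^ (52 * M) := by
          rw [hE₁, div_pow, ← pow_mul, show 4 * (13 * M) = 52 * M by ring]
          simp only [mul_pow, ← pow_mul]
          ring
  have hsecond : |(x₂ - α) * (taylor x₁ QR).coeff k| ≤ E₁ ^ M / q₂ ^ 4 := by
    have e1 := abs_taylor_coeff_le hQRd hR hx₁R (T := B ^ M)
      (fun i => by rw [hQR, coeff_map]; exact hQB i) k
    have e2 : R ^ D ≤ R ^ (34 * M) := pow_le_pow_right₀ hR (by omega)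
    have e3 : K ≤ K ^ (13 * M) := le_self_pow₀ hK (by omega)
    have e4 : u ^ M ≤ u ^ (2 * M) := pow_le_pow_right₀ (by norm_num [hu]) (by omega)
    have e5 : |x₂ - α| ≤ K / q₂ ^ 4 := by rwa [abs_sub_comm]
    rw [abs_mul]
    calc |x₂ - α| * |(taylor x₁ QR).coeff k|
        ≤ K / q₂ ^ 4 * (((D : ℝ) + 1) * 2 ^ D * B ^ M * R ^ D) := by gcongr
      _ ≤ K ^ (13 * M) / q₂ ^ 4 * (u ^ (2 * M) * B ^ M * R ^ (34 * M)) := by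
          gcongr
          exact hU.trans e4
      _ = E₁ ^ M / q₂ ^ 4 := by
          rw [hE₁]
          simp only [mul_pow, ← pow_mul]
          ring
  have hE₁0 : 0 ≤ E₁ ^ M := by positivity
  have htotal : 1 ≤ E₁ ^ M * q₂ / q₁ ^ (19 * M) + E₁ ^ M * q₁ ^ (33 * M) / q₂ ^ 3 := by
    have hvle : |v| ≤ E₁ ^ M / q₁ ^ (52 * M) + E₁ ^ M / q₂ ^ 4 := by
      rw [hsplit]
      exact (abs_add_le _ _).trans (add_le_add hfirst hsecond)
    rw [hNv, abs_mul, abs_of_pos (by positivity)] at hN1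
    refine hN1.trans ((mul_le_mul_of_nonneg_left hvle (by positivity)).trans_eq ?_)
    rw [show 52 * M = 33 * M + 19 * M by ring, pow_add, hD]
    field_simp
  have hpow : 2 * E₁ ^ M ≤ (2 * E₁) ^ M := by
    rw [mul_pow 2 E₁ M]
    exact mul_le_mul_of_nonneg_right (le_self_pow₀ (by norm_num) (by omega)) hE₁0
  rcases le_or_gt (1 / 2) (E₁ ^ M * q₂ / (q₁ : ℝ) ^ (19 * M)) with hc | hc
  · left
    rw [le_div_iff₀ (by positivity)] at hc
    have := mul_le_mul_of_nonneg_right hpow hq₂'.le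
    linarith
  · right
    have hc' : 1 / 2 ≤ E₁ ^ M * q₁ ^ (33 * M) / (q₂ : ℝ) ^ 3 := by linarith
    rw [le_div_iff₀ (by positivity)] at hc'
    have := mul_le_mul_of_nonneg_right hpow (pow_nonneg hq₁'.le (33 * M))
    linarith

theorem finite_of_denominator_bounded {α K : ℝ} (S : Set (ℤ × ℕ))
    (hS : ∀ s ∈ S, 0 < s.2 ∧ |α - s.1 / s.2| ≤ K) {N : ℕ} (hN : ∀ s ∈ S, s.2 ≤ N) :
    S.Finite := by
  have hsub : S ⊆ Set.Icc (-⌈(|α| + K) * N⌉) ⌈(|α| + K) * N⌉ ×ˢ Set.Icc 0 N := by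
    rintro ⟨p, q⟩ hs
    obtain ⟨hq, hle⟩ := hS _ hs
    have hqN : (q : ℝ) ≤ N := by exact_mod_cast hN _ hs
    have hq' : (0 : ℝ) < q := by exact_mod_cast hq
    have hp : |(p : ℝ)| ≤ (|α| + K) * N := by
      have h1 : |(p : ℝ) / q| ≤ |α| + K := by
        have := abs_sub_abs_le_abs_sub ((p : ℝ) / q) α
        rw [abs_sub_comm] at this
        simp only at hle
        linarith
      have h0 : 0 ≤ |α| + K := (abs_nonneg _).trans h1
      rw [abs_div, Nat.abs_cast, div_le_iff₀ hq'] at h1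
      exact h1.trans (by gcongr)
    have := abs_le.mp hp
    refine ⟨⟨?_, ?_⟩, Nat.zero_le _, hN _ hs⟩
    · have : -(p : ℝ) ≤ ⌈(|α| + K) * N⌉ := by linarith [Int.le_ceil ((|α| + K) * N)]
      have : -p ≤ ⌈(|α| + K) * N⌉ := by exact_mod_cast this
      simp only
      linarith
    · have : (p : ℝ) ≤ ⌈(|α| + K) * N⌉ := by linarith [Int.le_ceil ((|α| + K) * N)]
      exact_mod_cast this
  exact ((Set.finite_Icc _ _).prod (Set.finite_Icc _ _)).subset hsub

/-- **Thue's theorem** for algebraic integers of degree four. -/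
theorem finite_approximations_of_natDegree_minpoly_eq_four {α : ℝ} {c : Fin 4 → ℤ}
    (h : α ^ 4 = ∑ l, (c l : ℝ) * α ^ (l : ℕ)) (hdeg : (minpoly ℚ α).natDegree = 4) {K : ℝ}
    (hK : 1 ≤ K) : {s : ℤ × ℕ | 0 < s.2 ∧ |α - s.1 / s.2| ≤ K / s.2 ^ 4}.Finite := by
  set S := {s : ℤ × ℕ | 0 < s.2 ∧ |α - s.1 / s.2| ≤ K / s.2 ^ 4} with hS
  by_contra hinf
  have hlarge : ∀ N : ℕ, ∃ s ∈ S, N < s.2 := by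
    intro N
    by_contra! hN
    refine hinf (finite_of_denominator_bounded S (α := α) (K := K) ?_ hN)
    rintro ⟨p, q⟩ ⟨hq, hle⟩
    refine ⟨hq, hle.trans (div_le_self (by linarith) (one_le_pow₀ ?_))⟩
    exact_mod_cast hq
  obtain ⟨E, hE, hgap⟩ := exists_thue_gap h hdeg hK
  obtain ⟨⟨p₁, q₁⟩, ⟨hq₁, h₁⟩, hN₁⟩ := hlarge (⌈E⌉₊ + ⌈K⌉₊)
  obtain ⟨⟨p₂, q₂⟩, ⟨hq₂, h₂⟩, hN₂⟩ := hlarge (q₁ ^ 60)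
  simp only at hq₁ h₁ hN₁ hq₂ h₂ hN₂
  have hceilE := Nat.le_ceil E
  have hceilK := Nat.le_ceil K
  have hN₁' : ((⌈E⌉₊ : ℝ) + ⌈K⌉₊) < q₁ := by exact_mod_cast hN₁
  have hEq : E ≤ q₁ := by linarith
  have hq1 : (1 : ℝ) < q₁ := by linarith
  have hq1' : 1 < q₁ := by exact_mod_cast hq1
  have hKq : K ≤ (q₁ : ℝ) ^ 4 :=
    (show K ≤ q₁ by linarith).trans (le_self_pow₀ hq1.le (by norm_num))
  have hb : 1 < q₁ ^ 12 := Nat.one_lt_pow (by norm_num) hq1'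
  set M := Nat.log (q₁ ^ 12) q₂ with hM
  have hM5 : 5 ≤ M := by
    refine Nat.le_log_of_pow_le hb ?_
    rw [← pow_mul]
    exact hN₂.le
  have hlow : (q₁ : ℝ) ^ (12 * M) ≤ q₂ := by
    rw [pow_mul]; exact_mod_cast Nat.pow_log_le_self _ (by omega)
  have hhigh : (q₂ : ℝ) < q₁ ^ (12 * (M + 1)) := by
    rw [pow_mul]; exact_mod_cast Nat.lt_pow_succ_log_self hb _
  have hEM : E ^ M ≤ (q₁ : ℝ) ^ M := pow_le_pow_left₀ (by linarith) hEq _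
  rcases hgap p₁ p₂ q₁ q₂ M hq₁ hq₂ hM5 hKq h₁ h₂ with hc | hc
  · have : (q₁ : ℝ) ^ (19 * M) < q₁ ^ (M + 12 * (M + 1)) := by
      rw [pow_add]
      refine hc.trans_lt (mul_lt_mul' hEM hhigh (by positivity) (by positivity))
    have := (pow_lt_pow_iff_right₀ hq1).mp this
    omega
  · have : (q₁ : ℝ) ^ (12 * M * 3) ≤ q₁ ^ (M + 33 * M) := by
      rw [pow_add, pow_mul]
      exact (pow_le_pow_left₀ (by positivity) hlow 3).trans (hc.trans (by gcongr))
    have := (pow_le_pow_iff_right₀ hq1).mp this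
    omega

/-- Approximations of order four to a root of a monic integer quartic are finite in number, whatever
the degree of the root. -/
theorem finite_approximations_of_root {α : ℝ} {c : Fin 4 → ℤ}
    (h : α ^ 4 = ∑ l, (c l : ℝ) * α ^ (l : ℕ)) {K : ℝ} (hK : 1 ≤ K) :
    {s : ℤ × ℕ | 0 < s.2 ∧ (s.1 : ℝ) ≠ α * s.2 ∧ |α - s.1 / s.2| ≤ K / s.2 ^ 4}.Finite := by
  have hbdd : ∀ N : ℕ, (∀ s : ℤ × ℕ, 0 < s.2 → (s.1 : ℝ) ≠ α * s.2 →
      |α - s.1 / s.2| ≤ K / s.2 ^ 4 → s.2 ≤ N) →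
      {s : ℤ × ℕ | 0 < s.2 ∧ (s.1 : ℝ) ≠ α * s.2 ∧ |α - s.1 / s.2| ≤ K / s.2 ^ 4}.Finite := by
    intro N hN
    refine finite_of_denominator_bounded _ (α := α) (K := K) ?_ fun s hs => hN s hs.1 hs.2.1 hs.2.2
    rintro ⟨p, q⟩ ⟨hq, -, hle⟩
    refine ⟨hq, hle.trans (div_le_self (by linarith) (one_le_pow₀ ?_))⟩
    exact_mod_cast hq
  by_cases hirr : Irrational α
  · set f : ℤ[X] := X ^ 4 - ∑ l : Fin 4, C (c l) * X ^ (l : ℕ) with hf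
    have hlt : (∑ l : Fin 4, C (c l) * X ^ (l : ℕ)).degree < ((4 : ℕ) : WithBot ℕ) :=
      degree_sum_fin_lt c
    have hmonic : f.Monic := monic_X_pow_sub hlt
    have hfdeg : f.natDegree = 4 := natDegree_eq_of_degree_eq_some (by
      rw [hf, degree_sub_eq_left_of_degree_lt (by rwa [degree_X_pow]), degree_X_pow])
    have hroot : aeval α f = 0 := by
      simp [hf, h]
    have hint : IsIntegral ℤ α := ⟨f, hmonic, hroot⟩
    have hmap : minpoly ℚ α = (minpoly ℤ α).map (algebraMap ℤ ℚ) :=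
      minpoly.isIntegrallyClosed_eq_field_fractions' ℚ hint
    have hle4 : (minpoly ℤ α).natDegree ≤ 4 :=
      hfdeg ▸ natDegree_le_of_dvd (minpoly.isIntegrallyClosed_dvd hint hroot) hmonic.ne_zero
    rcases hle4.eq_or_lt with h4 | h3
    · refine (finite_approximations_of_natDegree_minpoly_eq_four h ?_ hK).subset
        fun s hs => ⟨hs.1, hs.2.2⟩
      rw [hmap, (minpoly.monic hint).natDegree_map, h4]
    · obtain ⟨A, hA, hL⟩ := Liouville.exists_pos_real_of_irrational_root hirr
        (minpoly.ne_zero hint) (by rw [eval_map_algebraMap]; exact minpoly.aeval ℤ α)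
      refine hbdd ⌈K * A⌉₊ fun ⟨p, q⟩ hq _ hle => ?_
      simp only at hq hle ⊢
      have hL' := hL p (q - 1)
      have hq1 : (1 : ℝ) ≤ q := by exact_mod_cast hq
      rw [Nat.cast_sub hq, Nat.cast_one, sub_add_cancel] at hL'
      have h5 : (1 : ℝ) ≤ q ^ 3 * (K / q ^ 4 * A) := by
        refine hL'.trans ?_
        have : (q : ℝ) ^ (minpoly ℤ α).natDegree ≤ q ^ 3 := pow_le_pow_right₀ hq1 (by omega)
        gcongr
      have h6 : (q : ℝ) ^ 3 * (K / q ^ 4 * A) = K * A / q := by field_simp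
      rw [h6, le_div_iff₀ (by linarith), one_mul] at h5
      exact_mod_cast h5.trans (Nat.le_ceil _)
  · obtain ⟨r, rfl⟩ := not_not.mp hirr
    refine hbdd ⌈K * r.den⌉₊ fun ⟨p, q⟩ hq hne hle => ?_
    simp only at hq hne hle ⊢
    have hq1 : (1 : ℝ) ≤ q := by exact_mod_cast hq
    have hd : (0 : ℝ) < r.den := by exact_mod_cast r.den_pos
    have hr : (r : ℝ) = r.num / r.den := by exact_mod_cast (Rat.num_div_den r).symm
    have hN : r.num * q - p * r.den ≠ 0 := by
      intro h0
      apply hne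
      have h0' : (r.num : ℝ) * q - p * r.den = 0 := by exact_mod_cast h0
      rw [hr]
      field_simp
      linarith
    have hN1 : (1 : ℝ) ≤ |(r.num : ℝ) * q - p * r.den| := by exact_mod_cast Int.one_le_abs hN
    have e : (r : ℝ) - p / q = ((r.num : ℝ) * q - p * r.den) / (r.den * q) := by
      rw [hr]; field_simp
    rw [e, abs_div, abs_of_pos (show (0 : ℝ) < r.den * q by positivity),
      div_le_div_iff₀ (by positivity) (by positivity)] at hle
    have h7 : (q : ℝ) ^ 4 ≤ K * r.den * q :=
      (le_mul_of_one_le_left (by positivity) hN1).trans (hle.trans_eq (by ring))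
    have h8 : (q : ℝ) ^ 3 ≤ K * r.den := by
      refine le_of_mul_le_mul_right ?_ (show (0 : ℝ) < q by linarith)
      linarith
    have h9 : (q : ℝ) ≤ K * r.den := (le_self_pow₀ hq1 (by norm_num)).trans h8
    exact_mod_cast h9.trans (Nat.le_ceil _)

/-- Thue's theorem for a monic binary quartic form that splits over `ℝ` into a form with two real
roots and a positive definite form. -/
theorem finite_quartic_form_eq_one {c : Fin 4 → ℤ} {u w δ ε : ℝ} (hδ : 0 < δ) (hε : 0 < ε)
    (hF : ∀ X Y : ℝ, X ^ 4 - ∑ l : Fin 4, (c l : ℝ) * X ^ (l : ℕ) * Y ^ (4 - (l : ℕ)) =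
      ((X - u * Y) ^ 2 - δ ^ 2 * Y ^ 2) * ((X - w * Y) ^ 2 + ε * Y ^ 2)) :
    {s : ℤ × ℤ | s.1 ^ 4 - ∑ l : Fin 4, c l * s.1 ^ (l : ℕ) * s.2 ^ (4 - (l : ℕ)) = 1}.Finite := by
  set K : ℝ := max 1 (1 / (δ * ε)) with hK
  have hroot : ∀ α : ℝ, (α - u) ^ 2 = δ ^ 2 → α ^ 4 = ∑ l, (c l : ℝ) * α ^ (l : ℕ) := by
    intro α hα
    have := hF α 1
    simp only [one_pow, mul_one, hα, sub_self, zero_mul] at this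
    linarith
  have hfin₁ := finite_approximations_of_root (hroot (u + δ) (by ring)) (le_max_left 1 (1 / (δ * ε)))
  have hfin₂ := finite_approximations_of_root (hroot (u - δ) (by ring)) (le_max_left 1 (1 / (δ * ε)))
  have hpos : ∀ (p : ℤ) (q : ℕ), 0 < q →
      (p : ℝ) ^ 4 - ∑ l : Fin 4, (c l : ℝ) * (p : ℝ) ^ (l : ℕ) * (q : ℝ) ^ (4 - (l : ℕ)) = 1 →
      (p, q) ∈ {s : ℤ × ℕ | 0 < s.2 ∧ (s.1 : ℝ) ≠ (u + δ) * s.2 ∧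
        |u + δ - s.1 / s.2| ≤ K / s.2 ^ 4} ∪
        {s : ℤ × ℕ | 0 < s.2 ∧ (s.1 : ℝ) ≠ (u - δ) * s.2 ∧
        |u - δ - s.1 / s.2| ≤ K / s.2 ^ 4} := by
    intro p q hq heq
    rw [hF] at heq
    have hq' : (0 : ℝ) < q := by exact_mod_cast hq
    set x : ℝ := p / q with hx
    have hp : (p : ℝ) = x * q := by rw [hx]; field_simp
    have hprod : (u + δ - x) * (u - δ - x) * ((x - w) ^ 2 + ε) * q ^ 4 = 1 := by
      rw [← heq, hp]; ring
    have hne₁ : u + δ - x ≠ 0 := by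
      rintro h0; rw [h0] at hprod; simp at hprod
    have hne₂ : u - δ - x ≠ 0 := by
      rintro h0; rw [h0] at hprod; simp at hprod
    have hpe : 0 < (x - w) ^ 2 + ε := by positivity
    have habs : |u + δ - x| * |u - δ - x| * ((x - w) ^ 2 + ε) * q ^ 4 = 1 := by
      have := congrArg abs hprod
      rwa [abs_mul, abs_mul, abs_mul, abs_of_pos hpe, abs_of_pos (show (0 : ℝ) < q ^ 4 by positivity),
        abs_one] at this
    have hle : |u + δ - x| * |u - δ - x| * (ε * q ^ 4) ≤ 1 := by
      rw [← habs, mul_assoc _ _ ((q : ℝ) ^ 4)]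
      gcongr
      nlinarith [sq_nonneg (x - w)]
    have hconc : ∀ a b : ℝ, 0 ≤ a → δ ≤ b → a * b * (ε * q ^ 4) ≤ 1 → a ≤ K / q ^ 4 := by
      intro a b ha hb hab
      rw [le_div_iff₀ (by positivity)]
      refine le_trans ?_ (le_max_right _ _)
      rw [le_div_iff₀ (by positivity)]
      calc a * q ^ 4 * (δ * ε) = a * δ * (ε * q ^ 4) := by ring
        _ ≤ a * b * (ε * q ^ 4) := by gcongr
        _ ≤ 1 := hab
    have hmax : δ ≤ |u + δ - x| ∨ δ ≤ |u - δ - x| := by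
      rcases le_or_gt x u with hxu | hxu
      · left; rw [le_abs]; left; linarith
      · right; rw [le_abs]; right; linarith
    rcases hmax with hm | hm
    · right
      refine ⟨hq, fun h0 => hne₂ ?_, hconc _ _ (abs_nonneg _) hm (by rwa [mul_comm |u - δ - x|])⟩
      rw [hx, h0]; field_simp; ring
    · left
      refine ⟨hq, fun h0 => hne₁ ?_, hconc _ _ (abs_nonneg _) hm hle⟩
      rw [hx, h0]; field_simp; ring
  have hfin := hfin₁.union hfin₂
  refine (((hfin.image fun s : ℤ × ℕ => (s.1, (s.2 : ℤ))).union
    (hfin.image fun s : ℤ × ℕ => (-s.1, -(s.2 : ℤ)))).union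
    ((Set.finite_Icc (-1 : ℤ) 1).image fun p => (p, (0 : ℤ)))).subset ?_
  rintro ⟨p, q⟩ hs
  simp only [Set.mem_ofPred_eq] at hs
  rcases lt_trichotomy q 0 with hq | rfl | hq
  · left; right
    refine ⟨(-p, (-q).toNat), hpos _ _ (by omega) ?_, ?_⟩
    · have hq' : (((-q).toNat : ℕ) : ℝ) = -(q : ℝ) := by
        have : (((-q).toNat : ℕ) : ℤ) = -q := Int.toNat_of_nonneg (by omega)
        exact_mod_cast congrArg (fun z : ℤ => (z : ℝ)) this
      rw [hq']
      have hs' : (p : ℝ) ^ 4 - ∑ l : Fin 4, (c l : ℝ) * (p : ℝ) ^ (l : ℕ) *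
        (q : ℝ) ^ (4 - (l : ℕ)) = 1 := by exact_mod_cast hs
      rw [← hs']
      simp [Fin.sum_univ_four]
      ring
    · have : (((-q).toNat : ℕ) : ℤ) = -q := Int.toNat_of_nonneg (by omega)
      exact Prod.ext (neg_neg p) (by simp only; omega)
  · right
    refine ⟨p, ?_, rfl⟩
    simp [Fin.sum_univ_four] at hs
    rw [pow_eq_one_iff_of_ne_zero (by norm_num)] at hs
    rcases hs with rfl | ⟨rfl, -⟩ <;> simp
  · left; left
    refine ⟨(p, q.toNat), hpos _ _ (by omega) ?_, ?_⟩
    · have hq' : ((q.toNat : ℕ) : ℝ) = (q : ℝ) := by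
        have : ((q.toNat : ℕ) : ℤ) = q := Int.toNat_of_nonneg (by omega)
        exact_mod_cast congrArg (fun z : ℤ => (z : ℝ)) this
      rw [hq']
      exact_mod_cast hs
    · exact Prod.ext rfl (Int.toNat_of_nonneg hq.le)

section BinaryQuartic

/-- The binary quartic form with coefficients `a`. -/
def quarticForm {R : Type*} [CommRing R] (a : Fin 5 → R) (X Y : R) : R :=
  a 0 * X ^ 4 + a 1 * X ^ 3 * Y + a 2 * X ^ 2 * Y ^ 2 + a 3 * X * Y ^ 3 + a 4 * Y ^ 4

/-- The coefficients of a binary quartic form after the substitution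
`(X, Y) ↦ (p X + r Y, q X + t Y)`. -/
def quarticSubst {R : Type*} [CommRing R] (a : Fin 5 → R) (p q r t : R) : Fin 5 → R :=
  ![a 0 * p ^ 4 + a 1 * p ^ 3 * q + a 2 * p ^ 2 * q ^ 2 + a 3 * p * q ^ 3 + a 4 * q ^ 4,
    4 * a 0 * p ^ 3 * r + a 1 * (3 * p ^ 2 * r * q + p ^ 3 * t) +
      a 2 * (2 * p * r * q ^ 2 + 2 * p ^ 2 * q * t) + a 3 * (r * q ^ 3 + 3 * p * q ^ 2 * t) +
      4 * a 4 * q ^ 3 * t,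
    6 * a 0 * p ^ 2 * r ^ 2 + a 1 * (3 * p * r ^ 2 * q + 3 * p ^ 2 * r * t) +
      a 2 * (r ^ 2 * q ^ 2 + 4 * p * r * q * t + p ^ 2 * t ^ 2) +
      a 3 * (3 * r * q ^ 2 * t + 3 * p * q * t ^ 2) + 6 * a 4 * q ^ 2 * t ^ 2,
    4 * a 0 * p * r ^ 3 + a 1 * (r ^ 3 * q + 3 * p * r ^ 2 * t) +
      a 2 * (2 * r ^ 2 * q * t + 2 * p * r * t ^ 2) + a 3 * (3 * r * q * t ^ 2 + p * t ^ 3) +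
      4 * a 4 * q * t ^ 3,
    a 0 * r ^ 4 + a 1 * r ^ 3 * t + a 2 * r ^ 2 * t ^ 2 + a 3 * r * t ^ 3 + a 4 * t ^ 4]

theorem quarticForm_quarticSubst {R : Type*} [CommRing R] (a : Fin 5 → R) (p q r t X Y : R) :
    quarticForm (quarticSubst a p q r t) X Y =
      quarticForm a (p * X + r * Y) (q * X + t * Y) := by
  simp [quarticForm, quarticSubst]
  ring

theorem quarticForm_injective {a b : Fin 5 → ℝ}
    (h : ∀ X Y, quarticForm a X Y = quarticForm b X Y) : a = b := by
  have h1 := h 1 0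
  have h2 := h 0 1
  have h3 := h 1 1
  have h4 := h 1 (-1)
  have h5 := h 2 1
  simp only [quarticForm] at h1 h2 h3 h4 h5
  funext i
  fin_cases i <;> simp <;> linarith

theorem intCast_quarticSubst {R : Type*} [CommRing R] (a : Fin 5 → ℤ) (p q r t : ℤ) :
    (fun i => ((quarticSubst a p q r t i : ℤ) : R)) =
      quarticSubst (fun i => (a i : R)) p q r t := by
  funext i
  fin_cases i <;> simp [quarticSubst]

theorem quarticForm_int_injective {a b : Fin 5 → ℤ}
    (h : ∀ X Y, quarticForm a X Y = quarticForm b X Y) : a = b := by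
  have h1 := h 1 0
  have h2 := h 0 1
  have h3 := h 1 1
  have h4 := h 1 (-1)
  have h5 := h 2 1
  simp only [quarticForm] at h1 h2 h3 h4 h5
  funext i
  fin_cases i <;> simp <;> linarith

/-- The coefficients of `(X² + η Y²) (A X² + B X Y + C Y²)` at `(X - ξ Y, Y)`, where the argument
is `(A, B, C, ξ, η)`. -/
def reducedCoeff (x : Fin 5 → ℝ) : Fin 5 → ℝ :=
  ![x 0,
    x 1 - 4 * x 3 * x 0,
    x 2 + x 4 * x 0 - 3 * x 3 * x 1 + 6 * x 3 ^ 2 * x 0,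
    x 4 * x 1 - 2 * x 3 * (x 2 + x 4 * x 0) + 3 * x 3 ^ 2 * x 1 - 4 * x 3 ^ 3 * x 0,
    x 4 * x 2 - x 3 * x 4 * x 1 + x 3 ^ 2 * (x 2 + x 4 * x 0) - x 3 ^ 3 * x 1 + x 3 ^ 4 * x 0]

theorem quarticForm_reducedCoeff (x : Fin 5 → ℝ) (X Y : ℝ) :
    quarticForm (reducedCoeff x) X Y = ((X - x 3 * Y) ^ 2 + x 4 * Y ^ 2) *
      (x 0 * (X - x 3 * Y) ^ 2 + x 1 * (X - x 3 * Y) * Y + x 2 * Y ^ 2) := by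
  simp [quarticForm, reducedCoeff]
  ring

theorem continuous_reducedCoeff : Continuous reducedCoeff := by
  refine continuous_pi fun i => ?_
  fin_cases i <;> simp [reducedCoeff] <;> fun_prop

/-- Reduction of a positive definite binary quadratic form `(X + u Y)² + ε Y²` under `SL₂(ℤ)`. -/
theorem exists_reduced_quadratic (u : ℝ) {ε : ℝ} (hε : 0 < ε) :
    ∃ (p q r t : ℤ) (ξ η μ : ℝ), p * t - q * r = 1 ∧ 0 < μ ∧ |ξ| ≤ 1 / 2 ∧ 1 ≤ ξ ^ 2 + η ^ 2 ∧
      ∀ X Y : ℝ, (p * X + r * Y + u * (q * X + t * Y)) ^ 2 + ε * (q * X + t * Y) ^ 2 =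
        μ * ((X - ξ * Y) ^ 2 + η ^ 2 * Y ^ 2) := by
  let z : UpperHalfPlane := ⟨⟨-u, √ε⟩, Real.sqrt_pos.mpr hε⟩
  obtain ⟨g, hg⟩ := ModularGroup.exists_smul_mem_fd z
  have hdet : g 0 0 * g 1 1 - g 0 1 * g 1 0 = 1 := by
    have := g.det_coe
    rwa [Matrix.det_fin_two] at this
  set w := g • z with hw
  have hden : ((g 1 0 : ℂ) * z + g 1 1) ≠ 0 := by
    have := UpperHalfPlane.denom_ne_zero g z
    simpa [UpperHalfPlane.denom] using this
  have hwz : (w : ℂ) * ((g 1 0 : ℂ) * z + g 1 1) = (g 0 0 : ℂ) * z + g 0 1 := by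
    rw [hw, UpperHalfPlane.specialLinearGroup_apply]
    simp
    exact div_mul_cancel₀ _ hden
  refine ⟨g 1 1, -g 1 0, -g 0 1, g 0 0, w.re, w.im, Complex.normSq ((g 1 0 : ℂ) * z + g 1 1),
    by linarith, Complex.normSq_pos.mpr hden, hg.2, ?_, fun X Y => ?_⟩
  · have := hg.1
    rw [Complex.normSq_apply] at this
    simp only [UpperHalfPlane.coe_re, UpperHalfPlane.coe_im] at this
    linarith
  · have e1 : (X - w.re * Y) ^ 2 + w.im ^ 2 * Y ^ 2 = Complex.normSq ((X : ℂ) - w * Y) := by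
      rw [Complex.normSq_apply]
      simp
      ring
    rw [e1, ← Complex.normSq_mul, show ((g 1 0 : ℂ) * z + g 1 1) * ((X : ℂ) - w * Y) =
      ((g 1 0 : ℂ) * z + g 1 1) * X - ((g 0 0 : ℂ) * z + g 0 1) * Y by rw [← hwz]; ring,
      Complex.normSq_apply]
    have hs : √ε * √ε = ε := Real.mul_self_sqrt hε.le
    simp [z]
    linear_combination (-(g 1 0 * X - g 0 0 * Y) ^ 2) * hs

set_option maxHeartbeats 800000 in
/-- Integral binary quartic forms with exactly two real roots and bounded invariants lie in
finitely many `SL₂(ℤ)`-classes. -/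
theorem exists_bounded_quarticSubst (K : ℝ) :
    ∃ N : ℤ, ∀ (a : Fin 5 → ℤ) (u d ε : ℝ), 0 < d → 0 < ε →
      (4 * u ^ 2 + ε - d) ^ 2 + 2 * d * ε ≤ K →
      (∀ X Y : ℝ, quarticForm (fun i => (a i : ℝ)) X Y =
        ((X - u * Y) ^ 2 - d * Y ^ 2) * ((X + u * Y) ^ 2 + ε * Y ^ 2)) →
      ∃ p q r t : ℤ, p * t - q * r = 1 ∧ ∀ i, |quarticSubst a p q r t i| ≤ N := by
  obtain ⟨M, hM⟩ := (isCompact_closedBall (0 : Fin 5 → ℝ) (3 * K + 1)).exists_bound_of_continuousOn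
    continuous_reducedCoeff.continuousOn
  refine ⟨⌈M⌉, fun a u d ε hd hε hK hF => ?_⟩
  obtain ⟨p, q, r, t, ξ, η, μ, hdet, hμ, hξ, hη, hg⟩ := exists_reduced_quadratic u hε
  refine ⟨p, q, r, t, hdet, ?_⟩
  have hdet' : (p : ℝ) * t - q * r = 1 := by exact_mod_cast hdet
  have h1 : (p + u * q) ^ 2 + ε * (q : ℝ) ^ 2 = μ := by linear_combination hg 1 0
  have h2 : (r + u * t) ^ 2 + ε * (t : ℝ) ^ 2 = μ * (ξ ^ 2 + η ^ 2) := by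
    linear_combination hg 0 1
  have h3 : (p + u * q) * (r + u * t) + ε * q * t = -(μ * ξ) := by
    linear_combination (hg 1 1 - hg 1 0 - hg 0 1) / 2
  have hμη : μ ^ 2 * η ^ 2 = ε := by
    have : μ * (μ * (ξ ^ 2 + η ^ 2)) - (-(μ * ξ)) ^ 2 = ε * ((p : ℝ) * t - q * r) ^ 2 := by
      rw [← h2, ← h3]
      nth_rewrite 1 [← h1]
      ring
    rw [hdet'] at this
    linear_combination this
  obtain ⟨A, hA⟩ : ∃ A, A = μ * ((p - u * q) ^ 2 - d * (q : ℝ) ^ 2) := ⟨_, rfl⟩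
  obtain ⟨B, hB⟩ : ∃ B, B = μ * (2 * (p - u * q) * (r - u * t) - 2 * d * q * (t : ℝ)) := ⟨_, rfl⟩
  obtain ⟨C, hC⟩ : ∃ C, C = μ * ((r - u * t) ^ 2 - d * (t : ℝ) ^ 2) := ⟨_, rfl⟩
  have hdisc : B ^ 2 - 4 * A * C = 4 * d * μ ^ 2 := by
    have : B ^ 2 - 4 * A * C = 4 * d * μ ^ 2 * ((p : ℝ) * t - q * r) ^ 2 := by
      rw [hA, hB, hC]; ring
    rw [this, hdet']; ring
  have hmix : C + (ξ ^ 2 + η ^ 2) * A + ξ * B = 4 * u ^ 2 + ε - d := by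
    have : C + (ξ ^ 2 + η ^ 2) * A + ξ * B =
        (4 * u ^ 2 + ε - d) * ((p : ℝ) * t - q * r) ^ 2 := by
      have e1 : C = ((p + u * q) ^ 2 + ε * (q : ℝ) ^ 2) * ((r - u * t) ^ 2 - d * (t : ℝ) ^ 2) := by
        rw [hC, h1]
      have e2 : (ξ ^ 2 + η ^ 2) * A =
          ((r + u * t) ^ 2 + ε * (t : ℝ) ^ 2) * ((p - u * q) ^ 2 - d * (q : ℝ) ^ 2) := by
        rw [hA, h2]; ring
      have e3 : ξ * B = -((p + u * q) * (r + u * t) + ε * q * t) *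
          (2 * (p - u * q) * (r - u * t) - 2 * d * q * (t : ℝ)) := by
        rw [hB, h3]; ring
      rw [e1, e2, e3]
      ring
    rw [this, hdet']; ring
  set B₁ := 2 * A * ξ + B with hB₁
  set C₁ := A * ξ ^ 2 + B * ξ + C with hC₁
  have hs : C₁ + η ^ 2 * A = 4 * u ^ 2 + ε - d := by rw [← hmix, hC₁]; ring
  have hD : η ^ 2 * B₁ ^ 2 - 4 * (η ^ 2 * A) * C₁ = 4 * d * ε := by
    rw [← hμη, hB₁, hC₁]
    linear_combination η ^ 2 * hdisc
  have hbound : (η ^ 2 * A) ^ 2 + C₁ ^ 2 + η ^ 2 * B₁ ^ 2 / 2 ≤ K := by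
    refine le_trans (le_of_eq ?_) hK
    rw [← hs]
    linear_combination hD / 2
  have hcoef : (fun i => ((quarticSubst a p q r t i : ℤ) : ℝ)) =
      reducedCoeff ![A, B₁, C₁, ξ, η ^ 2] := by
    rw [intCast_quarticSubst]
    refine quarticForm_injective fun X Y => ?_
    rw [quarticForm_quarticSubst, hF, hg, quarticForm_reducedCoeff]
    simp [hA, hB₁, hC₁, hB, hC]
    ring
  have hξ2 : ξ ^ 2 ≤ 1 / 4 := by
    have := sq_le_sq' (abs_le.mp hξ).1 (abs_le.mp hξ).2
    linarith
  have hη34 : 3 / 4 ≤ η ^ 2 := by linarith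
  have hdε : 0 < d * ε := mul_pos hd hε
  have hηA := sq_nonneg (η ^ 2 * A)
  have hC1 := sq_nonneg C₁
  have hηB : 0 ≤ η ^ 2 * B₁ ^ 2 := by positivity
  have hK0 : 0 ≤ K := by linarith
  have hA0 : ((quarticSubst a p q r t 0 : ℤ) : ℝ) = A := by
    simpa [reducedCoeff] using congrFun hcoef 0
  have hηle : η ^ 2 ≤ 2 * K + 1 := by
    by_cases h0 : quarticSubst a p q r t 0 = 0
    · have hAz : A = 0 := by rw [← hA0, h0]; simp
      have hB0 : ((quarticSubst a p q r t 1 : ℤ) : ℝ) = B₁ := by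
        simpa [reducedCoeff, hAz] using congrFun hcoef 1
      have hB0' : quarticSubst a p q r t 1 ≠ 0 := by
        intro h
        rw [← hB0, h, hAz] at hD
        simp at hD
        rcases hD with h | h <;> linarith
      have : (1 : ℝ) ≤ B₁ ^ 2 := by
        rw [← hB0]
        exact_mod_cast Int.one_le_abs (pow_ne_zero 2 hB0') |>.trans_eq (abs_sq _)
      have h4 := mul_le_mul_of_nonneg_left this (sq_nonneg η)
      linarith
    · have : (1 : ℝ) ≤ A ^ 2 := by
        rw [← hA0]
        exact_mod_cast Int.one_le_abs (pow_ne_zero 2 h0) |>.trans_eq (abs_sq _)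
      have h4 : (η ^ 2) ^ 2 * 1 ≤ (η ^ 2) ^ 2 * A ^ 2 :=
        mul_le_mul_of_nonneg_left this (sq_nonneg _)
      rw [← mul_pow] at h4
      linarith [sq_nonneg (η ^ 2 - 1)]
  have hmem : ![A, B₁, C₁, ξ, η ^ 2] ∈ Metric.closedBall (0 : Fin 5 → ℝ) (3 * K + 1) := by
    have hR : 0 ≤ 3 * K + 1 := by linarith
    rw [mem_closedBall_zero_iff, pi_norm_le_iff_of_nonneg hR]
    have hA2 : A ^ 2 ≤ 2 * K := by
      have h4 : (3 / 4 : ℝ) ^ 2 * A ^ 2 ≤ (η ^ 2) ^ 2 * A ^ 2 :=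
        mul_le_mul_of_nonneg_right (pow_le_pow_left₀ (by norm_num) hη34 2) (sq_nonneg A)
      rw [← mul_pow (η ^ 2)] at h4
      linarith [sq_nonneg A]
    have hB2 : B₁ ^ 2 ≤ 3 * K := by
      have h4 := mul_le_mul_of_nonneg_right hη34 (sq_nonneg B₁)
      linarith [sq_nonneg B₁]
    have key : ∀ {x : ℝ}, x ^ 2 ≤ 3 * K → |x| ≤ 3 * K + 1 := fun h =>
      abs_le_of_sq_le_sq (h.trans (by nlinarith)) hR
    intro i
    fin_cases i
    · exact key (hA2.trans (by linarith))
    · exact key hB2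
    · exact key ((by linarith : C₁ ^ 2 ≤ 3 * K))
    · exact hξ.trans (by linarith)
    · refine (abs_of_nonneg (sq_nonneg η)).trans_le (hηle.trans (by linarith))
  intro i
  have h5 := (norm_le_pi_norm _ i).trans (hM _ hmem)
  rw [← hcoef, Real.norm_eq_abs] at h5
  have h6 : |((quarticSubst a p q r t i : ℤ) : ℝ)| ≤ ⌈M⌉ := h5.trans (Int.le_ceil M)
  exact_mod_cast h6

end BinaryQuartic

section MordellEquation

/-- The coefficients of the binary quartic form attached to the point `(v, m)` of
`m² = v³ - 12 k² v - 20 k³`. -/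
def mordellQuartic (k v m : ℤ) : Fin 5 → ℤ :=
  ![1, 0, -6 * v, 8 * m, 48 * k ^ 2 - 3 * v ^ 2]

theorem exists_real_root {k : ℝ} (hk : k ≠ 0) :
    ∃ e : ℝ, e ^ 3 = 12 * k ^ 2 * e + 20 * k ^ 3 ∧ 16 * k ^ 2 < e ^ 2 := by
  have hc : ContinuousOn (fun x : ℝ => x ^ 3 - 12 * x - 20) (Set.Icc 4 5) := by fun_prop
  obtain ⟨s, hs, hs0⟩ := intermediate_value_Icc (by norm_num : (4 : ℝ) ≤ 5) hc
    (show (0 : ℝ) ∈ _ by constructor <;> norm_num)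
  simp only at hs0
  refine ⟨k * s, by linear_combination k ^ 3 * hs0, ?_⟩
  have hs4 : 4 < s := lt_of_le_of_ne hs.1 (by rintro rfl; norm_num at hs0)
  rw [mul_pow, mul_comm]
  exact mul_lt_mul_of_pos_left (by nlinarith) (by positivity)

theorem mordellQuartic_factor {k v m : ℤ} {e : ℝ}
    (he : e ^ 3 = 12 * k ^ 2 * e + 20 * k ^ 3) (hke : 16 * (k : ℝ) ^ 2 < e ^ 2)
    (hvm : m ^ 2 = v ^ 3 - 12 * k ^ 2 * v - 20 * k ^ 3) :
    ∃ u d ε : ℝ, 0 < d ∧ 0 < ε ∧ 4 * u ^ 2 + ε - d = -6 * e ∧ d * ε = 3 * e ^ 2 - 48 * k ^ 2 ∧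
      ∀ X Y : ℝ, quarticForm (fun i => (mordellQuartic k v m i : ℝ)) X Y =
        ((X - u * Y) ^ 2 - d * Y ^ 2) * ((X + u * Y) ^ 2 + ε * Y ^ 2) := by
  have hvm' : (m : ℝ) ^ 2 = v ^ 3 - 12 * k ^ 2 * v - 20 * k ^ 3 := by exact_mod_cast hvm
  have hpos : 0 < (v : ℝ) ^ 2 + e * v + e ^ 2 - 12 * k ^ 2 := by
    nlinarith [sq_nonneg (2 * (v : ℝ) + e)]
  obtain ⟨y, hy, hy0⟩ : ∃ y : ℝ, y ^ 2 = (v : ℝ) ^ 2 + e * v + e ^ 2 - 12 * k ^ 2 ∧ y < 0 :=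
    ⟨-√((v : ℝ) ^ 2 + e * v + e ^ 2 - 12 * k ^ 2), by rw [neg_sq, Real.sq_sqrt hpos.le],
      neg_lt_zero.mpr (Real.sqrt_pos.mpr hpos)⟩
  obtain ⟨u, hu⟩ : ∃ u : ℝ, u * y = m := ⟨m / y, div_mul_cancel₀ _ hy0.ne⟩
  have hu2 : u ^ 2 = v - e := by
    have : u ^ 2 * y ^ 2 = (v - e) * y ^ 2 := by
      rw [← mul_pow, hu, hvm', hy]
      linear_combination he
    exact mul_right_cancel₀ (pow_ne_zero 2 hy0.ne) this
  have habs : |2 * (v : ℝ) + e| < -2 * y :=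
    abs_lt_of_sq_lt_sq (by nlinarith) (by linarith)
  rw [abs_lt] at habs
  refine ⟨u, 2 * v + e - 2 * y, -(2 * v + e + 2 * y), by linarith, by linarith, by linarith,
    by linear_combination 4 * hy, fun X Y => ?_⟩
  simp [quarticForm, mordellQuartic]
  linear_combination (-8 * X * Y ^ 3) * hu + (2 * X ^ 2 * Y ^ 2 -
    (u ^ 2 + v - e - 2 * v - e + 2 * y - 2 * v - e - 2 * y) * Y ^ 4) * hu2 + 4 * Y ^ 4 * hy

theorem finite_mordellQuartic_class {k : ℤ} {e : ℝ}
    (he : e ^ 3 = 12 * k ^ 2 * e + 20 * k ^ 3) (hke : 16 * (k : ℝ) ^ 2 < e ^ 2)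
    (b : Fin 5 → ℤ) :
    {v : ℤ | ∃ m p q r t : ℤ, m ^ 2 = v ^ 3 - 12 * k ^ 2 * v - 20 * k ^ 3 ∧
      p * t - q * r = 1 ∧ quarticSubst (mordellQuartic k v m) p q r t = b}.Finite := by
  rcases Set.eq_empty_or_nonempty {v : ℤ | ∃ m p q r t : ℤ,
      m ^ 2 = v ^ 3 - 12 * k ^ 2 * v - 20 * k ^ 3 ∧
      p * t - q * r = 1 ∧ quarticSubst (mordellQuartic k v m) p q r t = b} with h | h
  · rw [h]; exact Set.finite_empty
  obtain ⟨v₀, m₀, p₀, q₀, r₀, t₀, hvm₀, hdet₀, hb₀⟩ := h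
  obtain ⟨u, d, ε, hd, hε, -, -, hF⟩ := mordellQuartic_factor he hke hvm₀
  have hfin := finite_quartic_form_eq_one
    (c := ![-(48 * k ^ 2 - 3 * v₀ ^ 2), -(8 * m₀), 6 * v₀, 0]) (u := u) (w := -u)
    (Real.sqrt_pos.mpr hd) hε (fun X Y => by
      rw [Real.sq_sqrt hd.le]
      have := hF X Y
      simp [quarticForm, mordellQuartic] at this
      simp [Fin.sum_univ_succ]
      linear_combination this)
  refine (hfin.image fun s => -(-v₀ * s.1 ^ 4 + 4 * m₀ * s.1 ^ 3 * s.2 +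
    ((48 * k ^ 2 - 3 * v₀ ^ 2) - 3 * v₀ ^ 2) * s.1 ^ 2 * s.2 ^ 2 + 4 * v₀ * m₀ * s.1 * s.2 ^ 3 +
    (-v₀ * (48 * k ^ 2 - 3 * v₀ ^ 2) - 4 * m₀ ^ 2) * s.2 ^ 4)).subset ?_
  rintro v ⟨m, p, q, r, t, -, hdet, hb⟩
  have hsub : mordellQuartic k v m = quarticSubst (mordellQuartic k v₀ m₀)
      (p₀ * t - r₀ * q) (q₀ * t - t₀ * q) (r₀ * p - p₀ * r) (t₀ * p - q₀ * r) := by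
    refine quarticForm_int_injective fun X Y => ?_
    have h := congrArg (fun a => quarticForm a (t * X - r * Y) (p * Y - q * X)) (hb.trans hb₀.symm)
    simp only [quarticForm_quarticSubst] at h ⊢
    rw [show p * (t * X - r * Y) + r * (p * Y - q * X) = X by linear_combination X * hdet,
      show q * (t * X - r * Y) + t * (p * Y - q * X) = Y by linear_combination Y * hdet] at h
    rw [h]
    congr 1 <;> ring
  have hdet' : (p₀ * t - r₀ * q) * (t₀ * p - q₀ * r) - (q₀ * t - t₀ * q) * (r₀ * p - p₀ * r) = 1 := by
    linear_combination (p * t - q * r) * hdet₀ + hdet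
  generalize p₀ * t - r₀ * q = P at *
  generalize q₀ * t - t₀ * q = Q at *
  generalize r₀ * p - p₀ * r = R at *
  generalize t₀ * p - q₀ * r = T at *
  have c0 := congrFun hsub 0
  have hess : 8 * quarticSubst (mordellQuartic k v₀ m₀) P Q R T 0 *
      quarticSubst (mordellQuartic k v₀ m₀) P Q R T 2 -
      3 * quarticSubst (mordellQuartic k v₀ m₀) P Q R T 1 ^ 2 =
      48 * (P * T - Q * R) ^ 2 * (-v₀ * P ^ 4 + 4 * m₀ * P ^ 3 * Q +
        ((48 * k ^ 2 - 3 * v₀ ^ 2) - 3 * v₀ ^ 2) * P ^ 2 * Q ^ 2 + 4 * v₀ * m₀ * P * Q ^ 3 +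
        (-v₀ * (48 * k ^ 2 - 3 * v₀ ^ 2) - 4 * m₀ ^ 2) * Q ^ 4) := by
    simp [mordellQuartic, quarticSubst]
    ring
  rw [← hsub, hdet'] at hess
  simp [mordellQuartic, quarticSubst] at c0 hess
  refine ⟨(P, Q), ?_, ?_⟩
  · simp [Fin.sum_univ_succ]
    linear_combination -c0
  · simp only
    linarith

/-- An elliptic curve of the form `m² = v³ - 12 k² v - 20 k³` has finitely many integral
points. -/
theorem finite_mordell {k : ℤ} (hk : k ≠ 0) :
    {v : ℤ | ∃ m : ℤ, m ^ 2 = v ^ 3 - 12 * k ^ 2 * v - 20 * k ^ 3}.Finite := by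
  obtain ⟨e, he, hke⟩ := exists_real_root (k := (k : ℝ)) (by exact_mod_cast hk)
  obtain ⟨N, hN⟩ := exists_bounded_quarticSubst
    ((-6 * e) ^ 2 + 2 * (3 * e ^ 2 - 48 * (k : ℝ) ^ 2))
  refine ((Set.finite_Icc (fun _ : Fin 5 => -N) (fun _ => N)).biUnion
    fun b _ => finite_mordellQuartic_class he hke b).subset ?_
  rintro v ⟨m, hvm⟩
  obtain ⟨u, d, ε, hd, hε, h1, h2, hF⟩ := mordellQuartic_factor he hke hvm
  obtain ⟨p, q, r, t, hdet, hle⟩ := hN (mordellQuartic k v m) u d ε hd hε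
    (by rw [h1, mul_assoc, h2]) hF
  simp only [Set.mem_iUnion]
  exact ⟨_, ⟨fun i => (abs_le.mp (hle i)).1, fun i => (abs_le.mp (hle i)).2⟩,
    m, p, q, r, t, hvm, hdet, rfl⟩

end MordellEquation

theorem finite_of_abs_le (b K : ℤ) : {n : ℤ | |3 * b - n| ≤ K}.Finite :=
  (Set.finite_Icc (3 * b - K) (3 * b + K)).subset fun n hn => by
    have := abs_le.mp (show |3 * b - n| ≤ K from hn)
    constructor <;> linarith

theorem abs_le_of_three_mul_sq_le {a M : ℤ} (h : 4 * a ^ 3 + 3 * M ^ 2 ≤ 0) :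
    |M| ≤ 4 * |a| ^ 3 := by
  have h1 : -a ^ 3 ≤ |a| ^ 3 := by
    rw [← abs_pow]; exact neg_le_abs _
  have h2 : |M| ≤ M ^ 2 := by
    rw [← sq_abs]
    exact Int.le_self_sq _
  nlinarith [sq_nonneg M]

theorem abs_le_of_sq_sub_sq_eq {s x c : ℤ} (hc : c ≠ 0) (h : s ^ 2 - x ^ 2 = c) : |x| ≤ |c| := by
  have h1 : (s - x) * (s + x) = c := by linear_combination h
  have h2 : |s - x| ≤ |c| := Int.le_of_dvd (abs_pos.mpr hc) ((abs_dvd_abs _ _).mpr (Dvd.intro _ h1))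
  have h3 : |s + x| ≤ |c| := 
    Int.le_of_dvd (abs_pos.mpr hc) ((abs_dvd_abs _ _).mpr (Dvd.intro_left _ h1))
  rw [abs_le] at *
  constructor <;> linarith

theorem exists_int_root_of_not_irreducible {A B D : ℤ}
    (h : ¬ Irreducible (X ^ 3 - C (A : ℚ) * X ^ 2 + C (B : ℚ) * X + C (D : ℚ))) :
    ∃ x : ℤ, x ^ 3 - A * x ^ 2 + B * x + D = 0 := by
  set f : ℤ[X] := X ^ 3 - C A * X ^ 2 + C B * X + C D with hf
  have hmap : f.map (Int.castRingHom ℚ) =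
      X ^ 3 - C (A : ℚ) * X ^ 2 + C (B : ℚ) * X + C (D : ℚ) := by
    simp [hf]
  have hmon : f.Monic := by rw [hf]; monicity!
  have hdeg : f.natDegree = 3 := by rw [hf]; compute_degree!
  rw [← hmap, Polynomial.Monic.irreducible_iff_roots_eq_zero_of_degree_le_three (hmon.map _)
    (by rw [hmon.natDegree_map, hdeg]; norm_num) (by rw [hmon.natDegree_map, hdeg])] at h
  obtain ⟨y, hy⟩ := Multiset.exists_mem_of_ne_zero h
  rw [mem_roots (hmon.map _).ne_zero, IsRoot, eval_map] at hy
  obtain ⟨x, rfl⟩ : ∃ x : ℤ, (x : ℚ) = y := by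
    obtain ⟨x, hx⟩ := IsIntegrallyClosed.isIntegral_iff.mp
      (show IsIntegral ℤ y from ⟨f, hmon, hy⟩)
    exact ⟨x, by simpa using hx⟩
  refine ⟨x, ?_⟩
  simp [hf] at hy
  exact_mod_cast hy

/-- For fixed `a b ∈ ℤ` with `a ≠ 0`, the set of integers `n` such that
(i) `Δ₁(n)` is a square in `ℚ`, or (ii) `Δ₂(n)` is a square in `ℚ`, or
(iii) `Δ₁(n) = 0` or `243(4a³ + 3(3b−n)²)` is a square in `ℚ`, or
(iv) `f₂ = X³ − 12aX² + 36a²X + (27(3b−n)² + 4a³)` is reducible in `ℚ[X]`, is finite. -/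
theorem bad_set_finite (a b : ℤ) (ha : a ≠ 0) :
    {n : ℤ |
      IsSquare ((-(4 * a ^ 3 + 27 * (3 * b - n) ^ 2) : ℤ) : ℚ) ∨
      IsSquare
        ((-243 * (4 * a ^ 3 + 27 * (3 * b - n) ^ 2) * (4 * a ^ 3 + 3 * (3 * b - n) ^ 2) : ℤ)
          : ℚ) ∨
      (-(4 * a ^ 3 + 27 * (3 * b - n) ^ 2) = 0 ∨
        IsSquare ((243 * (4 * a ^ 3 + 3 * (3 * b - n) ^ 2) : ℤ) : ℚ)) ∨
      ¬ Irreducible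
        (X ^ 3 - C (12 * (a : ℚ)) * X ^ 2 + C (36 * (a : ℚ) ^ 2) * X
          + C (27 * (3 * (b : ℚ) - (n : ℚ)) ^ 2 + 4 * (a : ℚ) ^ 3))}.Finite := by
  have hsq : ∀ z : ℤ, IsSquare (z : ℚ) → IsSquare z := fun z hz => Rat.isSquare_intCast_iff.mp hz
  have h12 : {n : ℤ | 4 * a ^ 3 + 3 * (3 * b - n) ^ 2 ≤ 0}.Finite :=
    (finite_of_abs_le b (4 * |a| ^ 3)).subset fun n hn => abs_le_of_three_mul_sq_le hn
  have h3 : {n : ℤ | IsSquare (243 * (4 * a ^ 3 + 3 * (3 * b - n) ^ 2))}.Finite := by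
    refine (finite_of_abs_le b |972 * a ^ 3|).subset ?_
    rintro n ⟨s, hs⟩
    have h := abs_le_of_sq_sub_sq_eq (s := s) (x := 27 * (3 * b - n)) (c := 972 * a ^ 3)
      (by positivity) (by linear_combination -hs)
    rw [abs_mul, abs_of_nonneg (by norm_num : (0 : ℤ) ≤ 27)] at h
    show |3 * b - n| ≤ |972 * a ^ 3|
    linarith [abs_nonneg (3 * b - n)]
  have h4 : {n : ℤ | ∃ x : ℤ, x ^ 3 - 12 * a * x ^ 2 + 36 * a ^ 2 * x +
      (27 * (3 * b - n) ^ 2 + 4 * a ^ 3) = 0}.Finite := by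
    have hE := finite_mordell (k := 3 * a) (by positivity)
    refine (hE.biUnion (t := fun v => {n : ℤ | (27 * (3 * b - n)) ^ 2 =
      v ^ 3 - 12 * (3 * a) ^ 2 * v - 20 * (3 * a) ^ 3}) fun v _ => ?_).subset ?_
    · refine (finite_of_abs_le b (|v ^ 3 - 12 * (3 * a) ^ 2 * v - 20 * (3 * a) ^ 3|)).subset ?_
      intro n hn
      have hn' : (27 * (3 * b - n)) ^ 2 = v ^ 3 - 12 * (3 * a) ^ 2 * v - 20 * (3 * a) ^ 3 := hn
      show |3 * b - n| ≤ _
      rw [← hn', abs_of_nonneg (sq_nonneg (27 * (3 * b - n)))]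
      have h := Int.le_self_sq |3 * b - n|
      rw [sq_abs] at h
      linarith [sq_nonneg (3 * b - n)]
    · rintro n ⟨x, hx⟩
      have h : (27 * (3 * b - n)) ^ 2 = (-3 * x + 12 * a) ^ 3 -
          12 * (3 * a) ^ 2 * (-3 * x + 12 * a) - 20 * (3 * a) ^ 3 := by
        linear_combination 27 * hx
      simp only [Set.mem_iUnion]
      exact ⟨-3 * x + 12 * a, ⟨_, h⟩, h⟩
  refine (h12.union (h3.union h4)).subset ?_
  rintro n (h | h | (h | h) | h)
  · have := (hsq _ h).nonneg
    exact Or.inl (show 4 * a ^ 3 + 3 * (3 * b - n) ^ 2 ≤ 0 by nlinarith [sq_nonneg (3 * b - n)])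
  · have := (hsq _ h).nonneg
    left
    show 4 * a ^ 3 + 3 * (3 * b - n) ^ 2 ≤ 0
    by_contra! hlt
    have h2 : 0 < 4 * a ^ 3 + 27 * (3 * b - n) ^ 2 := by nlinarith [sq_nonneg (3 * b - n)]
    nlinarith [mul_pos h2 hlt]
  · exact Or.inl (show 4 * a ^ 3 + 3 * (3 * b - n) ^ 2 ≤ 0 by nlinarith [sq_nonneg (3 * b - n)])
  · exact Or.inr (Or.inl (hsq _ h))
  · refine Or.inr (Or.inr (exists_int_root_of_not_irreducible ?_))
    push_cast
    exact h
end

section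
/- Let k be a field of characteristic different from 2 and 3 and let n ∈ k. Consider the homogeneous cubic G(x₀,x₁,x₂,x₃) = x₁(x₁+x₀)(x₁+2x₀) + x₂(x₂+x₀)(x₂+2x₀) + x₃(x₃+x₀)(x₃+2x₀) − 6n·x₀³. If there exists (x₀,x₁,x₂,x₃) ≠ (0,0,0,0) in k⁴ at which G and all four of its partial derivatives vanish, then 27·n² = 1 or 243·n² = 1. -/
/-- Let `k` have characteristic different from 2 and 3 and `n ∈ k`. If the homogeneous cubic
`G = Σᵢ xᵢ(xᵢ+x₀)(xᵢ+2x₀) − 6n x₀³` has a nontrivial common zero with all four of its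
partial derivatives in `k⁴`, then `27n² = 1` or `243n² = 1`. -/
theorem tetrahedral_singular_values {k : Type*} [Field k]
    (h2 : (2 : k) ≠ 0) (h3 : (3 : k) ≠ 0) (n : k)
    (h : ∃ x₀ x₁ x₂ x₃ : k,
      ¬(x₀ = 0 ∧ x₁ = 0 ∧ x₂ = 0 ∧ x₃ = 0) ∧
      x₁ * (x₁ + x₀) * (x₁ + 2 * x₀) + x₂ * (x₂ + x₀) * (x₂ + 2 * x₀)
        + x₃ * (x₃ + x₀) * (x₃ + 2 * x₀) - 6 * n * x₀ ^ 3 = 0 ∧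
      3 * x₁ ^ 2 + 6 * x₁ * x₀ + 2 * x₀ ^ 2 = 0 ∧
      3 * x₂ ^ 2 + 6 * x₂ * x₀ + 2 * x₀ ^ 2 = 0 ∧
      3 * x₃ ^ 2 + 6 * x₃ * x₀ + 2 * x₀ ^ 2 = 0 ∧
      -18 * n * x₀ ^ 2 + (3 * x₁ ^ 2 + 4 * x₁ * x₀) + (3 * x₂ ^ 2 + 4 * x₂ * x₀)
        + (3 * x₃ ^ 2 + 4 * x₃ * x₀) = 0) :
    27 * n ^ 2 = 1 ∨ 243 * n ^ 2 = 1 := by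
  obtain ⟨a, x, y, z, hne, hG, hx, hy, hz, -⟩ := h
  have ha : a ≠ 0 := by
    rintro rfl
    simp_all
  have ha2 : a ^ 2 ≠ 0 := pow_ne_zero 2 ha
  have hsum : (x + a) + (y + a) + (z + a) = -9 * n * a := by
    apply mul_left_cancel₀ (mul_ne_zero h2 ha2)
    linear_combination (x + a) * hx + (y + a) * hy + (z + a) * hz - 3 * hG
  have hsign : ∀ t : k, 3 * t ^ 2 + 6 * t * a + 2 * a ^ 2 = 0 →
      t + a = x + a ∨ t + a = -(x + a) := fun t ht ↦ by
    apply sq_eq_sq_iff_eq_or_eq_neg.mp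
    apply mul_left_cancel₀ h3
    linear_combination ht - hx
  have hsq : 3 * (x + a) ^ 2 = a ^ 2 := by linear_combination hx
  have hall : (x + a) ^ 2 = (9 * n * a) ^ 2 ∨ (3 * (x + a)) ^ 2 = (9 * n * a) ^ 2 := by
    rcases hsign y hy with hy' | hy' <;> rcases hsign z hz with hz' | hz' <;>
      rw [hy', hz'] at hsum
    · right
      linear_combination (3 * (x + a) - 9 * n * a) * hsum
    all_goals
      left
      first
      | linear_combination (x + a - 9 * n * a) * hsum
      | linear_combination (-(x + a) - 9 * n * a) * hsum
  rcases hall with hS | hS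
  · right
    apply mul_right_cancel₀ ha2
    linear_combination hsq - 3 * hS
  · left
    apply mul_left_cancel₀ (mul_ne_zero h3 ha2)
    linear_combination 3 * hsq - hS
end

section
/- For every n ∈ ℚ, the projective cubic surface X_n : x₁(x₁+x₀)(x₁+2x₀) + x₂(x₂+x₀)(x₂+2x₀) + x₃(x₃+x₀)(x₃+2x₀) = 6n·x₀³ in ℙ³_ℚ is smooth; concretely, for every (x₀,x₁,x₂,x₃) with coordinates in an algebraic closure of ℚ at which the defining cubic form G_n and all four of its partial derivatives vanish, one has x₀ = x₁ = x₂ = x₃ = 0. -/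
/-- The equation `3 q² = s²` has no rational solution with `s ≠ 0`. -/
theorem three_mul_sq_ne_sq (q s : ℚ) (hs : s ≠ 0) : 3 * q ^ 2 ≠ s ^ 2 := by
  intro h
  have hq : q ≠ 0 := by
    rintro rfl
    exact hs (by simpa using h.symm)
  have h3 : ¬ IsSquare (3 : ℚ) := by
    rw [show (3 : ℚ) = ((3 : ℕ) : ℚ) by norm_num, Rat.isSquare_natCast_iff]
    exact Nat.prime_three.prime.not_isSquare
  exact h3 ⟨s / q, by field_simp; linarith⟩

/-- If `3 y² = x²` and `s y = -9 n x` for rational `n` and `s ≠ 0`, then `x = 0`. -/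
theorem eq_zero_of_three_mul_sq_eq {K : Type*} [Field K] [CharZero K] (n s : ℚ) (hs : s ≠ 0)
    (x y : K) (hy : 3 * y ^ 2 = x ^ 2) (h : (s : K) * y = -9 * (n : K) * x) : x = 0 := by
  by_contra hx
  refine three_mul_sq_ne_sq (9 * n) s hs ?_
  have key : (3 * (9 * (n : K)) ^ 2 - (s : K) ^ 2) * x ^ 2 = 0 := by
    linear_combination (-3) * (s * y - 9 * n * x) * h + (s : K) ^ 2 * hy
  have := (mul_eq_zero.mp key).resolve_right (pow_ne_zero 2 hx)
  exact_mod_cast sub_eq_zero.mp this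

/-- For every `n ∈ ℚ`, the projective cubic surface
`X_n : Σᵢ xᵢ(xᵢ+x₀)(xᵢ+2x₀) = 6n x₀³ ⊂ ℙ³_ℚ` is smooth: any common zero over an algebraic
closure of `ℚ` of the defining cubic and all four partial derivatives is trivial. -/
theorem tetrahedral_surface_smooth (n : ℚ) (x₀ x₁ x₂ x₃ : AlgebraicClosure ℚ)
    (hG : x₁ * (x₁ + x₀) * (x₁ + 2 * x₀) + x₂ * (x₂ + x₀) * (x₂ + 2 * x₀)
      + x₃ * (x₃ + x₀) * (x₃ + 2 * x₀) - 6 * (n : AlgebraicClosure ℚ) * x₀ ^ 3 = 0)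
    (h1 : 3 * x₁ ^ 2 + 6 * x₁ * x₀ + 2 * x₀ ^ 2 = 0)
    (h2 : 3 * x₂ ^ 2 + 6 * x₂ * x₀ + 2 * x₀ ^ 2 = 0)
    (h3 : 3 * x₃ ^ 2 + 6 * x₃ * x₀ + 2 * x₀ ^ 2 = 0)
    (h0 : -18 * (n : AlgebraicClosure ℚ) * x₀ ^ 2 + (3 * x₁ ^ 2 + 4 * x₁ * x₀)
      + (3 * x₂ ^ 2 + 4 * x₂ * x₀) + (3 * x₃ ^ 2 + 4 * x₃ * x₀) = 0) :
    x₀ = 0 ∧ x₁ = 0 ∧ x₂ = 0 ∧ x₃ = 0 := by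
  have e1 : 3 * (x₁ + x₀) ^ 2 = x₀ ^ 2 := by linear_combination h1
  have e2 : 3 * (x₂ + x₀) ^ 2 = x₀ ^ 2 := by linear_combination h2
  have e3 : 3 * (x₃ + x₀) ^ 2 = x₀ ^ 2 := by linear_combination h3
  have hx : x₀ = 0 := by
    by_contra hx
    have hsum : (x₁ + x₀) + (x₂ + x₀) + (x₃ + x₀) = -9 * (n : AlgebraicClosure ℚ) * x₀ := by
      refine mul_left_cancel₀ (pow_ne_zero 2 hx) ?_
      linear_combination (-3 / 2) * hG + (1 / 2) * (x₁ + x₀) * e1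
        + (1 / 2) * (x₂ + x₀) * e2 + (1 / 2) * (x₃ + x₀) * e3
    have s2 : (x₂ + x₀) ^ 2 = (x₁ + x₀) ^ 2 := by linear_combination (e2 - e1) / 3
    have s3 : (x₃ + x₀) ^ 2 = (x₁ + x₀) ^ 2 := by linear_combination (e3 - e1) / 3
    rcases sq_eq_sq_iff_eq_or_eq_neg.mp s2 with t2 | t2 <;>
      rcases sq_eq_sq_iff_eq_or_eq_neg.mp s3 with t3 | t3
    · exact hx (eq_zero_of_three_mul_sq_eq n 3 (by norm_num) x₀ _ e1
        (by push_cast; linear_combination hsum - t2 - t3))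
    · exact hx (eq_zero_of_three_mul_sq_eq n 1 (by norm_num) x₀ _ e1
        (by push_cast; linear_combination hsum - t2 - t3))
    · exact hx (eq_zero_of_three_mul_sq_eq n 1 (by norm_num) x₀ _ e1
        (by push_cast; linear_combination hsum - t2 - t3))
    · exact hx (eq_zero_of_three_mul_sq_eq n (-1) (by norm_num) x₀ _ e1
        (by push_cast; linear_combination hsum - t2 - t3))
  subst hx
  refine ⟨rfl, ?_, ?_, ?_⟩
  · simpa using e1
  · simpa using e2
  · simpa using e3
end

section
/- For every integer n, the polynomial f₂ = X³ + 12X² + 36X + (972n² − 4) is irreducible in ℚ[X]. -/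
open Polynomial

theorem cubic_ne_zero_zmod_27 :
    ∀ x : ZMod 27, x ^ 3 + 12 * x ^ 2 + 36 * x - 4 ≠ 0 := by
  decide

theorem cubic_int_ne_zero (n m : ℤ) :
    m ^ 3 + 12 * m ^ 2 + 36 * m + (972 * n ^ 2 - 4) ≠ 0 := by
  intro h
  apply cubic_ne_zero_zmod_27 (m : ZMod 27)
  have h' := congrArg (Int.cast : ℤ → ZMod 27) h
  push_cast at h'
  have h972 : (972 : ZMod 27) = 0 := by decide
  linear_combination h' - (n : ZMod 27) ^ 2 * h972

/-- For every integer `n`, the polynomial `f₂ = X³ + 12X² + 36X + (972n² − 4)` is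
irreducible in `ℚ[X]`. -/
theorem tetrahedral_f2_irreducible (n : ℤ) :
    Irreducible (X ^ 3 + C (12 : ℚ) * X ^ 2 + C (36 : ℚ) * X
      + C (972 * (n : ℚ) ^ 2 - 4)) := by
  have hdeg : (X ^ 3 + C (12 : ℚ) * X ^ 2 + C (36 : ℚ) * X
      + C (972 * (n : ℚ) ^ 2 - 4)).natDegree = 3 := by compute_degree!
  rw [irreducible_iff_roots_eq_zero_of_degree_le_three (by lia) (by lia)]
  refine Multiset.eq_zero_of_forall_notMem fun x hx ↦ ?_
  have hroot := isRoot_of_mem_roots hx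
  simp only [IsRoot.def, eval_add, eval_mul, eval_pow, eval_X, eval_C] at hroot
  have hmonic : (X ^ 3 + C (12 : ℤ) * X ^ 2 + C (36 : ℤ) * X
      + C (972 * n ^ 2 - 4)).Monic := by monicity!
  obtain ⟨m, rfl⟩ := isInteger_of_is_root_of_monic hmonic (r := x) (by
    simpa only [map_add, map_mul, map_pow, aeval_X, aeval_C, algebraMap_int_eq,
      map_sub, map_ofNat, Int.coe_castRingHom] using hroot)
  refine cubic_int_ne_zero n m ?_
  rw [eq_intCast] at hroot
  exact_mod_cast hroot
end

section
/- Let n ∈ ℤ and suppose the polynomial f₁ = X³ − X − 6n is irreducible over ℚ. Then the splitting field K over ℚ of the product f₁·f₂, where f₂ = X³ + 12X² + 36X + (972n² − 4), satisfies [K : ℚ] = 36. -/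
open Polynomial

theorem Equiv.Perm.eq_one_of_forall_commute {α : Type*} [Finite α] (hα : 3 ≤ Nat.card α)
    {c : Equiv.Perm α} (hc : ∀ g, Commute g c) : c = 1 := by
  classical
  have := Fintype.ofFinite α
  ext a
  by_contra ha
  have ha : c a ≠ a := ha
  obtain ⟨b, hb⟩ : ∃ b, b ∉ ({a, c a} : Finset α) := by
    by_contra! h
    have h1 : Finset.univ.card ≤ ({a, c a} : Finset α).card :=
      Finset.card_le_card fun x _ ↦ h x
    have h2 := Finset.card_le_two (a := a) (b := c a)
    rw [Finset.card_univ, ← Nat.card_eq_fintype_card] at h1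
    omega
  simp only [Finset.mem_insert, Finset.mem_singleton, not_or] at hb
  have h := congrArg (fun σ : Equiv.Perm α ↦ σ a) (hc (Equiv.swap (c a) b)).eq
  simp only [Equiv.Perm.mul_apply, Equiv.swap_apply_left,
    Equiv.swap_apply_of_ne_of_ne ha.symm (Ne.symm hb.1)] at h
  exact hb.2 h

/-- A subgroup `G` of `S₃ × A` with `|A| = 6` which surjects onto both factors and has order
divisible by `4` is everything. -/
theorem card_eq_of_surjective_perm_of_surjective {G A α : Type*} [Group G] [Group A] [Finite G]
    (hα : Nat.card α = 3) (hA : Nat.card A = 6)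
    (φ : G →* Equiv.Perm α) (ψ : G →* A) (hφ : Function.Surjective φ)
    (hψ : Function.Surjective ψ) (hinj : ∀ g, φ g = 1 → ψ g = 1 → g = 1)
    (h4 : 4 ∣ Nat.card G) : Nat.card G = 36 := by
  have : Finite α := Nat.finite_of_card_ne_zero (by omega)
  have hperm : Nat.card (Equiv.Perm α) = 6 := by rw [Nat.card_perm, hα]; rfl
  have hcard : Nat.card ψ.ker * 6 = Nat.card G := by
    rw [← ψ.ker.card_mul_index, Subgroup.index_ker, MonoidHom.range_eq_top.mpr hψ,
      Subgroup.card_top, hA]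
  have hdvd : Nat.card ψ.ker ∣ 6 := by
    rw [← hperm]
    refine Subgroup.card_dvd_of_injective (φ.comp ψ.ker.subtype) ?_
    rw [injective_iff_map_eq_one]
    exact fun g hg ↦ Subtype.ext (hinj g hg g.2)
  have hne : Nat.card ψ.ker ≠ 2 := by
    intro h2
    obtain ⟨x, y, hxy, huniv⟩ := Nat.card_eq_two_iff.mp h2
    obtain ⟨c, hc⟩ : ∃ c : ψ.ker, c ≠ 1 := by
      by_contra! h
      exact hxy ((h x).trans (h y).symm)
    have huniq : ∀ g : ψ.ker, g ≠ 1 → g = c := by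
      have hmem : ∀ z : ψ.ker, z = x ∨ z = y := fun z ↦ by
        simpa using (huniv ▸ Set.mem_univ z : z ∈ ({x, y} : Set ψ.ker))
      intro g hg
      grind [hmem g, hmem c, hmem 1]
    have hcomm : ∀ g : G, Commute g (c : G) := by
      intro g
      have := huniq ⟨g * c * g⁻¹, ψ.normal_ker.conj_mem c c.2 g⟩ fun h ↦ hc <| by
        have h := congrArg Subtype.val h
        exact Subtype.ext (by simpa using h)
      have := congrArg Subtype.val this
      exact mul_inv_eq_iff_eq_mul.mp this
    refine hc (Subtype.ext (hinj c ?_ c.2))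
    refine Equiv.Perm.eq_one_of_forall_commute hα.ge fun σ ↦ ?_
    obtain ⟨g, rfl⟩ := hφ σ
    exact (hcomm g).map φ
  have hle := Nat.le_of_dvd (by norm_num) hdvd
  interval_cases Nat.card ψ.ker <;> omega

section Sqrt

variable {F L : Type*} [Field F] [Field L] [Algebra F L]

theorem finrank_adjoin_of_sq_eq {a : F} {d : L} (hd : d ^ 2 = algebraMap F L a)
    (ha : ¬ IsSquare a) : Module.finrank F (IntermediateField.adjoin F {d}) = 2 := by
  have hirr : Irreducible (X ^ 2 - C a) :=
    X_pow_sub_C_irreducible_of_prime Nat.prime_two fun b hb ↦ ha ⟨b, by rw [← hb, sq]⟩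
  have hmonic : (X ^ 2 - C a).Monic := monic_X_pow_sub_C a two_ne_zero
  have hroot : aeval d (X ^ 2 - C a) = 0 := by simp [hd]
  have hint : IsIntegral F d := ⟨_, hmonic, by simpa [aeval_def] using hroot⟩
  rw [IntermediateField.adjoin.finrank hint,
    ← minpoly.eq_of_irreducible_of_monic hirr hroot hmonic, natDegree_X_pow_sub_C]

theorem two_dvd_finrank_of_sq_eq [FiniteDimensional F L] {a : F} {d : L}
    (hd : d ^ 2 = algebraMap F L a) (ha : ¬ IsSquare a) : 2 ∣ Module.finrank F L :=
  ⟨Module.finrank (IntermediateField.adjoin F {d}) L, by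
    rw [← finrank_adjoin_of_sq_eq hd ha, Module.finrank_mul_finrank]⟩

theorem isSquare_or_isSquare_mul_of_isSquare_adjoin (h2 : (2 : F) ≠ 0) {a b : F} {d : L}
    (hd : d ^ 2 = algebraMap F L a) (ha : ¬ IsSquare a)
    (hb : IsSquare (algebraMap F (IntermediateField.adjoin F {d}) b)) :
    IsSquare b ∨ IsSquare (a * b) := by
  obtain ⟨⟨e, he⟩, hbe⟩ := hb
  have hbe : algebraMap F L b = e * e := congrArg Subtype.val hbe
  have hmonic : (X ^ 2 - C a).Monic := monic_X_pow_sub_C a two_ne_zero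
  have hroot : aeval d (X ^ 2 - C a) = 0 := by simp [hd]
  have hint : IsIntegral F d := ⟨_, hmonic, by simpa [aeval_def] using hroot⟩
  rw [← IntermediateField.mem_toSubalgebra,
    IntermediateField.adjoin_simple_toSubalgebra_of_isAlgebraic hint.isAlgebraic,
    Algebra.adjoin_singleton_eq_range_aeval] at he
  obtain ⟨p, hp⟩ := he
  have hlt : (p %ₘ (X ^ 2 - C a)).natDegree < 2 := by
    have hdeg : (X ^ 2 - C a).natDegree = 2 := natDegree_X_pow_sub_C
    exact (natDegree_modByMonic_lt p hmonic fun h ↦ by simp [h] at hdeg).trans_eq hdeg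
  obtain ⟨u, v, huv⟩ := exists_eq_X_add_C_of_natDegree_le_one (Nat.le_of_lt_succ hlt)
  have hp : e = algebraMap F L u * d + algebraMap F L v := by
    have h := aeval_modByMonic_eq_self_of_root hroot (p := p)
    rw [huv] at h
    rw [← hp, AlgHom.toRingHom_eq_coe, RingHom.coe_coe, ← h]
    simp
  have key : algebraMap F L (2 * u * v) * d = algebraMap F L (b - u ^ 2 * a - v ^ 2) := by
    simp only [map_mul, map_sub, map_pow, map_ofNat, hbe, hp, ← hd]
    ring
  have huv0 : u = 0 ∨ v = 0 := by
    by_contra! h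
    have h0 : 2 * u * v ≠ 0 := mul_ne_zero (mul_ne_zero h2 h.1) h.2
    refine ha ⟨(b - u ^ 2 * a - v ^ 2) / (2 * u * v), (algebraMap F L).injective ?_⟩
    rw [map_mul, map_div₀, ← key, mul_div_cancel_left₀ _ (by simpa using h0), ← hd, sq]
  have hb : b = u ^ 2 * a + v ^ 2 := by
    have h0 : algebraMap F L (2 * u * v) = 0 := by
      rcases huv0 with h | h <;> simp [h]
    rw [h0, zero_mul, eq_comm, map_eq_zero] at key
    linear_combination key
  rcases huv0 with rfl | rfl
  · exact Or.inl ⟨v, by rw [hb]; ring⟩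
  · exact Or.inr ⟨u * a, by rw [hb]; ring⟩

theorem four_dvd_finrank_of_sq_eq [FiniteDimensional F L] (h2 : (2 : F) ≠ 0) {a b : F} {d e : L}
    (hd : d ^ 2 = algebraMap F L a) (he : e ^ 2 = algebraMap F L b)
    (ha : ¬ IsSquare a) (hb : ¬ IsSquare b) (hab : ¬ IsSquare (a * b)) :
    4 ∣ Module.finrank F L := by
  have h : 2 ∣ Module.finrank (IntermediateField.adjoin F {d}) L := by
    refine two_dvd_finrank_of_sq_eq
      (a := algebraMap F (IntermediateField.adjoin F {d}) b) (d := e) ?_ fun h ↦ ?_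
    · rw [he, ← IsScalarTower.algebraMap_apply]
    · exact (isSquare_or_isSquare_mul_of_isSquare_adjoin h2 hd ha h).elim hb hab
  rw [← Module.finrank_mul_finrank F (IntermediateField.adjoin F {d}) L,
    finrank_adjoin_of_sq_eq hd ha]
  omega

end Sqrt

namespace Cubic

variable {F : Type*} [Field F]

theorem exists_sq_eq_discr {K : Type*} [Field K] [Algebra F K] {P : Cubic F} (ha : P.a ≠ 0)
    (hs : (P.toPoly.map (algebraMap F K)).Splits) :
    ∃ d : K, d ^ 2 = algebraMap F K P.discr := by
  obtain ⟨x, y, z, h⟩ := (splits_iff_roots_eq_three ha).mp hs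
  exact ⟨_, (discr_eq_prod_three_roots ha h).symm⟩

theorem card_rootSet_eq_three [CharZero F] {P : Cubic F} (ha : P.a ≠ 0)
    (hirr : Irreducible P.toPoly) :
    Nat.card (P.toPoly.rootSet P.toPoly.SplittingField) = 3 := by
  rw [Nat.card_eq_fintype_card, card_rootSet_eq_natDegree hirr.separable
    (SplittingField.splits _), natDegree_of_a_ne_zero ha]

theorem card_gal_eq_six [CharZero F] {P : Cubic F} (ha : P.a ≠ 0)
    (hirr : Irreducible P.toPoly) (hd : ¬ IsSquare P.discr) : Nat.card P.toPoly.Gal = 6 := by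
  have h3 : 3 ∣ Nat.card P.toPoly.Gal := by
    have hdeg := natDegree_of_a_ne_zero ha
    rw [← hdeg]
    exact Gal.prime_degree_dvd_card hirr (hdeg ▸ Nat.prime_three)
  have h2 : 2 ∣ Nat.card P.toPoly.Gal := by
    rw [Gal.card_of_separable hirr.separable]
    obtain ⟨d, h⟩ := exists_sq_eq_discr ha (SplittingField.splits P.toPoly)
    exact two_dvd_finrank_of_sq_eq h hd
  have h6 : Nat.card P.toPoly.Gal ∣ 6 := by
    have : Fact ((P.toPoly.map (algebraMap F P.toPoly.SplittingField)).Splits) :=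
      ⟨SplittingField.splits _⟩
    have := Subgroup.card_dvd_of_injective _
      (Gal.galActionHom_injective P.toPoly P.toPoly.SplittingField)
    rwa [Nat.card_perm, card_rootSet_eq_three ha hirr] at this
  have hle := Nat.le_of_dvd (by norm_num) h6
  interval_cases Nat.card P.toPoly.Gal <;> omega

/-- The splitting field of the product of two irreducible cubics, whose discriminants are
nonsquares in different square classes, has degree `36`. -/
theorem finrank_splittingField_mul [CharZero F] {P Q : Cubic F} (hP : P.a ≠ 0) (hQ : Q.a ≠ 0)
    (hPirr : Irreducible P.toPoly) (hQirr : Irreducible Q.toPoly)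
    (hPd : ¬ IsSquare P.discr) (hQd : ¬ IsSquare Q.discr) (hPQ : ¬ IsSquare (P.discr * Q.discr)) :
    Module.finrank F (P.toPoly * Q.toPoly).SplittingField = 36 := by
  have h0 : P.toPoly * Q.toPoly ≠ 0 := mul_ne_zero hPirr.ne_zero hQirr.ne_zero
  have hsplit := SplittingField.splits (P.toPoly * Q.toPoly)
  have hsplit0 : (P.toPoly * Q.toPoly).map
      (algebraMap F (P.toPoly * Q.toPoly).SplittingField) ≠ 0 := Polynomial.map_ne_zero h0
  obtain ⟨d, hd⟩ := exists_sq_eq_discr hP (hsplit.of_dvd hsplit0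
    (Polynomial.map_dvd _ (dvd_mul_right P.toPoly Q.toPoly)))
  obtain ⟨e, he⟩ := exists_sq_eq_discr hQ (hsplit.of_dvd hsplit0
    (Polynomial.map_dvd _ (dvd_mul_left Q.toPoly P.toPoly)))
  have h4 := four_dvd_finrank_of_sq_eq two_ne_zero hd he hPd hQd hPQ
  have hcard : Nat.card (P.toPoly * Q.toPoly).Gal =
      Module.finrank F (P.toPoly * Q.toPoly).SplittingField := by
    have : IsGalois F (P.toPoly * Q.toPoly).SplittingField := ⟨⟩
    exact IsGalois.card_aut_eq_finrank F (P.toPoly * Q.toPoly).SplittingField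
  rw [← hcard] at h4 ⊢
  have : Fact ((P.toPoly.map (algebraMap F P.toPoly.SplittingField)).Splits) :=
    ⟨SplittingField.splits _⟩
  have hroots := card_rootSet_eq_three hP hPirr
  have hinj := Gal.galActionHom_injective P.toPoly P.toPoly.SplittingField
  have hbij : Function.Bijective (Gal.galActionHom P.toPoly P.toPoly.SplittingField) := by
    rw [Nat.bijective_iff_injective_and_card]
    refine ⟨hinj, ?_⟩
    rw [card_gal_eq_six hP hPirr hPd, Nat.card_perm, hroots]
    rfl
  refine card_eq_of_surjective_perm_of_surjective hroots (card_gal_eq_six hQ hQirr hQd)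
    ((Gal.galActionHom P.toPoly P.toPoly.SplittingField).comp
      (Gal.restrictDvd (dvd_mul_right P.toPoly Q.toPoly)))
    (Gal.restrictDvd (dvd_mul_left Q.toPoly P.toPoly))
    (hbij.2.comp (Gal.restrictDvd_surjective _ h0)) (Gal.restrictDvd_surjective _ h0) ?_ h4
  intro g hg₁ hg₂
  refine Gal.restrictProd_injective P.toPoly Q.toPoly ?_
  rw [map_one]
  exact Prod.ext (hinj (hg₁.trans (map_one _).symm)) hg₂

end Cubic

theorem irreducible_tetrahedral_resolvent (n : ℤ) :
    Irreducible (Cubic.toPoly ⟨1, 12, 36, 972 * (n : ℚ) ^ 2 - 4⟩) := by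
  have hdeg : (Cubic.toPoly ⟨1, 12, 36, 972 * (n : ℚ) ^ 2 - 4⟩).natDegree = 3 :=
    Cubic.natDegree_of_a_ne_zero' one_ne_zero
  rw [irreducible_iff_roots_eq_zero_of_degree_le_three (by omega) hdeg.le]
  refine Multiset.eq_zero_of_forall_notMem fun r hr ↦ ?_
  have hroot : r ^ 3 + 12 * r ^ 2 + 36 * r + (972 * (n : ℚ) ^ 2 - 4) = 0 := by
    have := isRoot_of_mem_roots hr
    simpa [Cubic.toPoly, IsRoot] using this
  obtain ⟨x, rfl⟩ : ∃ x : ℤ, (x : ℚ) = r := by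
    refine isInteger_of_is_root_of_monic
      (p := Cubic.toPoly ⟨1, 12, 36, 972 * n ^ 2 - 4⟩) Cubic.monic_of_a_eq_one' ?_
    simp only [Cubic.toPoly, map_add, map_mul, map_pow, aeval_X, aeval_C]
    simpa using hroot
  have hx : x ^ 3 + 12 * x ^ 2 + 36 * x + (972 * n ^ 2 - 4) = 0 := by exact_mod_cast hroot
  have hmod : (x : ZMod 27) ^ 3 + 12 * x ^ 2 + 36 * x - 4 = 0 := by
    have := congrArg (Int.cast : ℤ → ZMod 27) hx
    push_cast at this
    rw [show (972 : ZMod 27) = 0 from rfl] at this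
    linear_combination this
  revert hmod
  generalize (x : ZMod 27) = y
  revert y
  decide

theorem not_isSquare_three_mul (n : ℤ) : ¬ IsSquare (3 * (27 * (n : ℚ) ^ 2 - 1)) := by
  intro h
  have h : IsSquare (3 * (27 * n ^ 2 - 1)) := by
    rw [← Rat.isSquare_intCast_iff]
    exact_mod_cast h
  obtain ⟨m, hm⟩ := h
  have h3 : 3 ∣ m := Int.prime_three.dvd_of_dvd_pow (n := 2) ⟨27 * n ^ 2 - 1, by rw [hm]; ring⟩
  obtain ⟨k, rfl⟩ := h3
  have : 9 * n ^ 2 * 3 - 1 = 3 * (k * k) := by linarith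
  omega

/-- Let `n ∈ ℤ` and suppose `f₁ = X³ − X − 6n` is irreducible over `ℚ`. Then the splitting
field over `ℚ` of `f₁·f₂`, where `f₂ = X³ + 12X² + 36X + (972n² − 4)`, has degree 36. -/
theorem tetrahedral_splitting_degree (n : ℤ)
    (f₁ f₂ : ℚ[X])
    (hf₁ : f₁ = X ^ 3 - X - C (6 * (n : ℚ)))
    (hf₂ : f₂ = X ^ 3 + C (12 : ℚ) * X ^ 2 + C (36 : ℚ) * X + C (972 * (n : ℚ) ^ 2 - 4))
    (hirr : Irreducible f₁) :
    Module.finrank ℚ (f₁ * f₂).SplittingField = 36 := by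
  have hn : n ≠ 0 := by
    rintro rfl
    have hdeg : f₁.natDegree = 3 := by rw [hf₁]; compute_degree!
    have hroots := (irreducible_iff_roots_eq_zero_of_degree_le_three (by omega) hdeg.le).mp hirr
    have h0 : (0 : ℚ) ∈ f₁.roots := (mem_roots hirr.ne_zero).mpr (by simp [hf₁])
    simp [hroots] at h0
  have hn1 : (1 : ℚ) ≤ (n : ℚ) ^ 2 := by
    exact_mod_cast (one_le_sq_iff_one_le_abs _).mpr (Int.one_le_abs hn)
  have hP : f₁ = Cubic.toPoly ⟨1, 0, -1, -(6 * (n : ℚ))⟩ := by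
    simp [hf₁, Cubic.toPoly]; ring
  have hQ : f₂ = Cubic.toPoly ⟨1, 12, 36, 972 * (n : ℚ) ^ 2 - 4⟩ := by
    simp [hf₂, Cubic.toPoly]
  have hPd : Cubic.discr ⟨1, 0, -1, -(6 * (n : ℚ))⟩ = 4 * (1 - 243 * (n : ℚ) ^ 2) := by
    simp only [Cubic.discr]; ring
  have hQd : Cubic.discr ⟨1, 12, 36, 972 * (n : ℚ) ^ 2 - 4⟩ =
      -3888 * (243 * (n : ℚ) ^ 2 - 1) * (27 * (n : ℚ) ^ 2 - 1) := by
    simp only [Cubic.discr]; ring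
  rw [hP] at hirr ⊢
  rw [hQ]
  refine Cubic.finrank_splittingField_mul one_ne_zero one_ne_zero hirr
    (irreducible_tetrahedral_resolvent n) ?_ ?_ ?_
  · intro h
    have := h.nonneg
    rw [hPd] at this
    linarith
  · intro h
    have := h.nonneg
    rw [hQd] at this
    nlinarith
  · rw [hPd, hQd]
    rintro ⟨r, hr⟩
    refine not_isSquare_three_mul n ⟨r / (72 * (243 * (n : ℚ) ^ 2 - 1)), ?_⟩
    have h0 : 243 * (n : ℚ) ^ 2 - 1 ≠ 0 := by linarith
    rw [div_mul_div_comm, ← hr, eq_div_iff (by positivity)]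
    ring
end

section
/- For every integer n and every prime number p, there exist u₁, u₂, u₃ in the ring ℤ_p of p-adic integers such that u₁(u₁+1)(u₁+2) + u₂(u₂+1)(u₂+2) + u₃(u₃+1)(u₃+2) = 6n. -/
open Polynomial in
/-- A root of `x ^ 3 - x = c` modulo `p` that is simple lifts to a `p`-adic root. -/
theorem PadicInt.exists_cube_sub_self_eq {p : ℕ} [Fact p.Prime] (c : ℤ_[p]) (a : ZMod p)
    (ha : a ^ 3 - a = PadicInt.toZMod c) (ha' : 3 * a ^ 2 - 1 ≠ 0) :
    ∃ z : ℤ_[p], z ^ 3 - z = c := by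
  have hker (x : ℤ_[p]) : ‖x‖ < 1 ↔ PadicInt.toZMod x = 0 := by
    rw [← RingHom.mem_ker, PadicInt.ker_toZMod, IsLocalRing.mem_maximalIdeal,
      PadicInt.mem_nonunits]
  obtain ⟨b, rfl⟩ := ZMod.ringHom_surjective (PadicInt.toZMod (p := p)) a
  have hder : ‖(X ^ 3 - X - C c : ℤ_[p][X]).derivative.aeval b‖ = 1 := by
    refine le_antisymm (PadicInt.norm_le_one _) (not_lt.mp fun h ↦ ha' ?_)
    rw [hker] at h
    simp only [derivative_X_pow, derivative_X, derivative_C, map_sub, map_mul, map_pow, map_one,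
      map_zero, aeval_X, Nat.cast_ofNat, map_ofNat] at h
    linear_combination h
  obtain ⟨z, hz, -⟩ := hensels_lemma (F := (X ^ 3 - X - C c : ℤ_[p][X])) (a := b) (by
    rw [hder, one_pow, hker]
    simp [ha])
  exact ⟨z, by simpa [sub_eq_zero] using hz⟩

open Polynomial in
theorem card_filter_cube_sub_self_le {F : Type*} [Field F] [Fintype F] [DecidableEq F] (c : F) :
    (Finset.univ.filter fun x : F ↦ x ^ 3 - x = c).card ≤ 3 := by
  have hdeg : (X ^ 3 - X - C c : F[X]).natDegree = 3 := by compute_degree!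
  have hne : (X ^ 3 - X - C c : F[X]) ≠ 0 := by
    intro h
    simp [h] at hdeg
  calc _ ≤ (X ^ 3 - X - C c : F[X]).roots.toFinset.card := by
        refine Finset.card_le_card fun x hx ↦ ?_
        have hx : x ^ 3 - x = c := by simpa using hx
        simp [hne, hx]
    _ ≤ 3 := (Multiset.toFinset_card_le _).trans ((card_roots' _).trans hdeg.le)

/-- The fibres of `x ↦ x ^ 3 - x` have at most three points; since `3` does not divide `|F|`, some
fibre has fewer, and by oddness there are two such fibres. -/
theorem card_add_two_le_three_mul_card_image_cube_sub_self {F : Type*} [Field F] [Fintype F]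
    [DecidableEq F] (h2 : (2 : F) ≠ 0) (h3 : ¬ 3 ∣ Fintype.card F) :
    Fintype.card F + 2 ≤ 3 * (Finset.univ.image fun x : F ↦ x ^ 3 - x).card := by
  set B := Finset.univ.image fun x : F ↦ x ^ 3 - x with hB
  let N (c : F) : ℕ := (Finset.univ.filter fun x : F ↦ x ^ 3 - x = c).card
  have hN (c : F) : N c ≤ 3 := card_filter_cube_sub_self_le c
  have hsum : Fintype.card F = ∑ c ∈ B, N c :=
    Finset.card_eq_sum_card_image (fun x : F ↦ x ^ 3 - x) Finset.univ
  obtain ⟨c, hcB, hc⟩ : ∃ c ∈ B, N c ≠ 3 := by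
    by_contra! h
    rw [Finset.sum_congr rfl h, Finset.sum_const, smul_eq_mul] at hsum
    exact h3 ⟨_, hsum.trans (mul_comm _ _)⟩
  have hneg : N (-c) ≤ N c := by
    refine Finset.card_le_card_of_injOn (fun x ↦ -x) (fun x hx ↦ ?_) neg_injective.injOn
    have hx : x ^ 3 - x = -c := by simpa using hx
    have : (-x) ^ 3 - -x = c := by linear_combination -hx
    simpa using this
  have hc0 : c ≠ 0 := by
    rintro rfl
    have h1 : (1 : F) ≠ -1 := fun h ↦ h2 (by linear_combination h)
    have hcard : ({0, 1, -1} : Finset F).card = 3 :=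
      Finset.card_eq_three.mpr ⟨0, 1, -1, by simp, by simp, h1, rfl⟩
    refine hc (le_antisymm (hN 0) (hcard.symm.le.trans (Finset.card_le_card ?_)))
    intro x hx
    simp only [Finset.mem_insert, Finset.mem_singleton] at hx
    rcases hx with rfl | rfl | rfl <;> norm_num
  have hcne : -c ≠ c := fun h ↦
    (mul_ne_zero h2 hc0) (by linear_combination -h)
  have hcB' : -c ∈ B.erase c := by
    obtain ⟨x, -, hx⟩ := Finset.mem_image.mp hcB
    refine Finset.mem_erase.mpr ⟨hcne, Finset.mem_image.mpr ⟨-x, Finset.mem_univ _, ?_⟩⟩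
    linear_combination -hx
  have hrest : ∑ b ∈ (B.erase c).erase (-c), N b ≤ ((B.erase c).erase (-c)).card * 3 :=
    Finset.sum_le_card_nsmul _ _ _ fun b _ ↦ hN b
  have e1 := Finset.add_sum_erase B N hcB
  have e2 := Finset.add_sum_erase (B.erase c) N hcB'
  have e3 := Finset.card_erase_add_one hcB
  have e4 := Finset.card_erase_add_one hcB'
  have := hN c
  omega

/-- At a critical point `x` of `x ↦ x ^ 3 - x`, the point `-2 * x` has the same value and is not
critical. -/
theorem exists_cube_sub_self_eq_and_derivative_ne_zero {F : Type*} [Field F] (h3 : (3 : F) ≠ 0)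
    (x : F) : ∃ y : F, y ^ 3 - y = x ^ 3 - x ∧ 3 * y ^ 2 - 1 ≠ 0 := by
  by_cases hx : 3 * x ^ 2 - 1 = 0
  · exact ⟨-2 * x, by linear_combination -3 * x * hx,
      fun h ↦ h3 (by linear_combination h - 4 * hx)⟩
  · exact ⟨x, rfl, hx⟩

open scoped Pointwise in
theorem ZMod.exists_sum_three_cube_sub_self_eq {p : ℕ} [Fact p.Prime] (hp2 : p ≠ 2) (hp3 : p ≠ 3)
    (c : ZMod p) : ∃ x y z : ZMod p, x ^ 3 - x + (y ^ 3 - y) + (z ^ 3 - z) = c := by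
  have hp := Fact.out (p := p.Prime)
  have h2 : (2 : ZMod p) ≠ 0 := fun h ↦ hp2
    ((Nat.prime_dvd_prime_iff_eq hp Nat.prime_two).mp
      ((ZMod.natCast_eq_zero_iff 2 p).mp (by exact_mod_cast h)))
  have h3 : ¬ 3 ∣ Fintype.card (ZMod p) := by
    rw [ZMod.card]
    exact fun h ↦ hp3 ((Nat.prime_dvd_prime_iff_eq Nat.prime_three hp).mp h).symm
  have hcard := card_add_two_le_three_mul_card_image_cube_sub_self h2 h3
  set B := Finset.univ.image fun x : ZMod p ↦ x ^ 3 - x with hB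
  have hBne : B.Nonempty := Finset.univ_nonempty.image _
  have k1 := ZMod.cauchy_davenport hp hBne hBne
  have k2 := ZMod.cauchy_davenport hp (hBne.add hBne) hBne
  have huniv : B + B + B = Finset.univ := by
    rw [← Finset.card_eq_iff_eq_univ]
    refine le_antisymm (Finset.card_le_univ _) ?_
    have := hBne.card_pos
    rw [ZMod.card] at hcard ⊢
    omega
  have hc : c ∈ B + B + B := huniv ▸ Finset.mem_univ c
  simp only [Finset.mem_add, hB, Finset.mem_image, Finset.mem_univ, true_and] at hc
  obtain ⟨_, ⟨_, ⟨x, rfl⟩, _, ⟨y, rfl⟩, rfl⟩, _, ⟨z, rfl⟩, rfl⟩ := hc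
  exact ⟨x, y, z, rfl⟩

theorem ZMod.exists_smooth_sum_three_cube_sub_self_eq {p : ℕ} [Fact p.Prime] (n : ZMod p) :
    ∃ x y z : ZMod p, x ^ 3 - x + (y ^ 3 - y) + (z ^ 3 - z) = 6 * n ∧ 3 * x ^ 2 - 1 ≠ 0 := by
  by_cases h6 : (6 : ZMod p) = 0
  · exact ⟨0, 0, 0, by simp [h6], by simp⟩
  have h3 : (3 : ZMod p) ≠ 0 := fun h ↦ h6 (by linear_combination 2 * h)
  have hp2 : p ≠ 2 := by
    rintro rfl
    exact h6 rfl
  have hp3 : p ≠ 3 := by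
    rintro rfl
    exact h6 rfl
  obtain ⟨x, y, z, h⟩ := ZMod.exists_sum_three_cube_sub_self_eq hp2 hp3 (6 * n)
  obtain ⟨x', hx', hx⟩ := exists_cube_sub_self_eq_and_derivative_ne_zero h3 x
  exact ⟨x', y, z, by rw [hx', h], hx⟩

/-- For every integer `n` and every prime `p`, the equation
`u₁(u₁+1)(u₁+2) + u₂(u₂+1)(u₂+2) + u₃(u₃+1)(u₃+2) = 6n` has a solution in the `p`-adic
integers. -/
theorem tetrahedral_padic_soluble (n : ℤ) (p : ℕ) [Fact p.Prime] :
    ∃ u₁ u₂ u₃ : ℤ_[p],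
      u₁ * (u₁ + 1) * (u₁ + 2) + u₂ * (u₂ + 1) * (u₂ + 2) + u₃ * (u₃ + 1) * (u₃ + 2)
        = 6 * (n : ℤ_[p]) := by
  obtain ⟨x, y, z, h, hx⟩ := ZMod.exists_smooth_sum_three_cube_sub_self_eq (n : ZMod p)
  obtain ⟨v, rfl⟩ := ZMod.ringHom_surjective (PadicInt.toZMod (p := p)) y
  obtain ⟨w, rfl⟩ := ZMod.ringHom_surjective (PadicInt.toZMod (p := p)) z
  obtain ⟨u, hu⟩ := PadicInt.exists_cube_sub_self_eq
    (6 * (n : ℤ_[p]) - (v ^ 3 - v) - (w ^ 3 - w)) x (by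
      simp only [map_sub, map_mul, map_pow, map_intCast, map_ofNat]
      linear_combination h) hx
  exact ⟨u - 1, v - 1, w - 1, by linear_combination hu⟩
end

section
/- For every prime number p and every integer n, there exist x₀, x₁, x₂, x₃ ∈ 𝔽_p with x₀ ≠ 0 such that G_n(x₀,x₁,x₂,x₃) := x₁(x₁+x₀)(x₁+2x₀) + x₂(x₂+x₀)(x₂+2x₀) + x₃(x₃+x₀)(x₃+2x₀) − 6n·x₀³ = 0 and at least one of the four partial derivatives ∂G_n/∂x₀, ∂G_n/∂x₁, ∂G_n/∂x₂, ∂G_n/∂x₃ is nonzero at (x₀,x₁,x₂,x₃). -/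
open scoped Pointwise in
/-- If a set of residues has at least `(p + 2) / 3` elements, then every residue is a sum of
three of its elements. -/
theorem ZMod.exists_add_add_eq_of_card {p : ℕ} (hp : p.Prime) {A : Finset (ZMod p)}
    (hA : p + 2 ≤ 3 * A.card) (c : ZMod p) :
    ∃ a ∈ A, ∃ b ∈ A, ∃ d ∈ A, a + b + d = c := by
  have : Fact p.Prime := ⟨hp⟩
  have hne : A.Nonempty := by
    rw [← Finset.card_pos]
    omega
  have h₁ := ZMod.cauchy_davenport hp hne hne
  have h₂ := ZMod.cauchy_davenport hp (hne.add hne) hne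
  have hle : (A + A + A).card ≤ p := by
    simpa [ZMod.card] using Finset.card_le_univ (A + A + A)
  have huniv : A + A + A = Finset.univ := by
    rw [← Finset.card_eq_iff_eq_univ, ZMod.card]
    have := hp.two_le
    omega
  have hc : c ∈ A + A + A := huniv ▸ Finset.mem_univ c
  obtain ⟨s, hs, d, hd, rfl⟩ := Finset.mem_add.mp hc
  obtain ⟨a, ha, b, hb, rfl⟩ := Finset.mem_add.mp hs
  exact ⟨a, ha, b, hb, d, hd, rfl⟩

/-- A finite set stable under negation and containing `0` has odd cardinality when `2` is not a
zero divisor. -/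
theorem Finset.odd_card_of_neg_mem {F : Type*} [Field F] [DecidableEq F] (h2 : (2 : F) ≠ 0)
    {A : Finset F} (h0 : 0 ∈ A) (hneg : ∀ a ∈ A, -a ∈ A) : Odd A.card := by
  have hsum : ∑ _a ∈ A.erase 0, (1 : ZMod 2) = 0 := by
    refine Finset.sum_involution (fun a _ => -a) (fun _ _ => by decide) ?_ ?_ ?_
    · intro a ha _ h
      have : 2 * a = 0 := by linear_combination -h
      exact (Finset.ne_of_mem_erase ha) ((mul_eq_zero.mp this).resolve_left h2)
    · intro a ha
      rw [Finset.mem_erase] at ha ⊢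
      exact ⟨neg_ne_zero.mpr ha.1, hneg a ha.2⟩
    · intro a _
      exact neg_neg a
  have heven : Even (A.erase 0).card := by
    rw [← ZMod.natCast_eq_zero_iff_even]
    simpa using hsum
  rw [← Finset.card_erase_add_one h0]
  exact heven.add_one

theorem card_filter_cube_sub_self_eq_le {F : Type*} [Field F] [Fintype F] [DecidableEq F]
    (a : F) : (Finset.univ.filter fun y : F => y ^ 3 - y = a).card ≤ 3 := by
  open Polynomial in
  have hdeg : (X ^ 3 - X - C a : F[X]).natDegree = 3 := by compute_degree!
  have hne : (X ^ 3 - X - C a : F[X]) ≠ 0 := by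
    intro h
    simp [h] at hdeg
  refine (Polynomial.card_le_degree_of_subset_roots (p := X ^ 3 - X - C a) ?_).trans hdeg.le
  intro y hy
  have hy' : y ^ 3 - y = a := by simpa using hy
  simp [Polynomial.mem_roots hne, hy']

theorem ZMod.card_image_cube_sub_self {p : ℕ} [Fact p.Prime] (hp : 5 ≤ p) :
    p + 2 ≤ 3 * (Finset.univ.image fun y : ZMod p => y ^ 3 - y).card := by
  have hprime : p.Prime := Fact.out
  have h2 : (2 : ZMod p) ≠ 0 := by
    intro h
    have := Nat.le_of_dvd two_pos ((ZMod.natCast_eq_zero_iff 2 p).mp (mod_cast h))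
    omega
  have hcard : p ≤ 3 * (Finset.univ.image fun y : ZMod p => y ^ 3 - y).card := by
    simpa [ZMod.card] using Finset.card_le_mul_card_image (f := fun y : ZMod p => y ^ 3 - y)
      Finset.univ 3 fun a _ => card_filter_cube_sub_self_eq_le a
  have hodd : Odd (Finset.univ.image fun y : ZMod p => y ^ 3 - y).card := by
    refine Finset.odd_card_of_neg_mem h2 (Finset.mem_image.mpr ⟨0, Finset.mem_univ _, by ring⟩) ?_
    intro a ha
    obtain ⟨y, -, rfl⟩ := Finset.mem_image.mp ha
    exact Finset.mem_image.mpr ⟨-y, Finset.mem_univ _, by ring⟩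
  have hp2 : p % 2 = 1 := hprime.eq_two_or_odd.resolve_left (by omega)
  have hp3 : p % 3 ≠ 0 := fun h => by
    have := (Nat.prime_dvd_prime_iff_eq Nat.prime_three hprime).mp (Nat.dvd_of_mod_eq_zero h)
    omega
  obtain ⟨k, hk⟩ := hodd
  omega

/-- Away from characteristic `3`, every value of `y ^ 3 - y` is taken at a noncritical point:
if `r` is critical, then `-2 * r` has the same value and is not critical. -/
theorem exists_noncritical_cube_sub_self_eq {F : Type*} [Field F] (h3 : (3 : F) ≠ 0) (r : F) :
    ∃ y : F, y ^ 3 - y = r ^ 3 - r ∧ 3 * y ^ 2 - 1 ≠ 0 := by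
  by_cases hr : 3 * r ^ 2 - 1 = 0
  · refine ⟨-2 * r, by linear_combination (-3 * r) * hr, fun h => h3 ?_⟩
    linear_combination h - 4 * hr
  · exact ⟨r, rfl, hr⟩


/-- For every prime `p` and every integer `n`, the special fibre at `p` of the
sum-of-three-tetrahedral-numbers surface has a smooth `𝔽_p`-point away from the
hyperplane `x₀ = 0`: there exist `x₀ x₁ x₂ x₃ ∈ 𝔽_p` with `x₀ ≠ 0` at which the cubic
`G_n` vanishes and at least one of its four partial derivatives does not vanish. -/
theorem tetrahedral_smooth_Fp_point (p : ℕ) (hp : p.Prime) (n : ℤ) :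
    ∃ x₀ x₁ x₂ x₃ : ZMod p, x₀ ≠ 0 ∧
      x₁ * (x₁ + x₀) * (x₁ + 2 * x₀) + x₂ * (x₂ + x₀) * (x₂ + 2 * x₀)
        + x₃ * (x₃ + x₀) * (x₃ + 2 * x₀) - 6 * (n : ZMod p) * x₀ ^ 3 = 0 ∧
      (-18 * (n : ZMod p) * x₀ ^ 2 + (3 * x₁ ^ 2 + 4 * x₁ * x₀)
          + (3 * x₂ ^ 2 + 4 * x₂ * x₀) + (3 * x₃ ^ 2 + 4 * x₃ * x₀) ≠ 0 ∨
        3 * x₁ ^ 2 + 6 * x₁ * x₀ + 2 * x₀ ^ 2 ≠ 0 ∨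
        3 * x₂ ^ 2 + 6 * x₂ * x₀ + 2 * x₀ ^ 2 ≠ 0 ∨
        3 * x₃ ^ 2 + 6 * x₃ * x₀ + 2 * x₀ ^ 2 ≠ 0) := by
  have : Fact p.Prime := ⟨hp⟩
  by_cases h6 : (6 : ZMod p) = 0
  · refine ⟨1, -1, 0, 0, one_ne_zero, by linear_combination (-(n : ZMod p)) * h6, ?_⟩
    exact Or.inr (Or.inl fun h => one_ne_zero (by linear_combination -h))
  · have h3 : (3 : ZMod p) ≠ 0 := fun h => h6 (by linear_combination 2 * h)
    have hp5 : 5 ≤ p := by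
      by_contra! hlt
      have hdvd : ¬ p ∣ 6 := fun h => h6 (mod_cast (ZMod.natCast_eq_zero_iff 6 p).mpr h)
      have := hp.two_le
      interval_cases p
      · exact hdvd (by norm_num)
      · exact hdvd (by norm_num)
      · exact absurd hp (by norm_num)
    obtain ⟨a, ha, b, hb, d, hd, hsum⟩ := ZMod.exists_add_add_eq_of_card hp
      (ZMod.card_image_cube_sub_self hp5) (6 * (n : ZMod p))
    obtain ⟨r, -, rfl⟩ := Finset.mem_image.mp ha
    obtain ⟨y₂, -, rfl⟩ := Finset.mem_image.mp hb
    obtain ⟨y₃, -, rfl⟩ := Finset.mem_image.mp hd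
    obtain ⟨y₁, hy, hcrit⟩ := exists_noncritical_cube_sub_self_eq h3 r
    refine ⟨1, y₁ - 1, y₂ - 1, y₃ - 1, one_ne_zero, by linear_combination hsum + hy, ?_⟩
    exact Or.inr (Or.inl fun h => hcrit (by linear_combination h))
end
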